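/- arXiv:1710.10591 — 2 statements merged into one kernel-verified Lean document; each statement's English description precedes it below -/
import Mathlib

section
/- Assume (A1), (A3), (A4) below, let V_N ⊆ V be a finite-dimensional subspace, let u_{N,0} ∈ V_N, and let u_N : [0,T] → V_N be absolutely continuous with u_N(0) = u_{N,0} such that there exists f_N ∈ L¹(0,T;H) with (u_N'(t),v) + a(u_N(t),v) = (f_N(t),v) for all v ∈ V_N and a.e. t ∈ (0,T), and f_N(t) ∈ F(t,u_N(t)) for a.e. t ∈ (0,T). Then, with K₁ := exp(‖ℓ‖_{L¹(0,T)})·(‖u_{N,0}‖_H + ‖α‖_{L¹(0,T)}), one has c_a·∫₀ᵀ ‖u_N(t)‖_V² dt ≤ ‖u_{N,0}‖_H²/2 + K₁·(K₁·‖ℓ‖_{L¹(0,T)} + ‖α‖_{L¹(0,T)}). -/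
open MeasureTheory Set Filter Metric
open scoped Topology
open scoped RealInnerProductSpace

theorem ac_of_dist_le {X Y : Type*} [PseudoMetricSpace X] [PseudoMetricSpace Y]
    {f : ℝ → X} {g : ℝ → Y} {a b C : ℝ}
    (hg : AbsolutelyContinuousOnInterval g a b)
    (h : ∀ x ∈ uIcc a b, ∀ y ∈ uIcc a b, dist (f x) (f y) ≤ C * dist (g x) (g y)) :
    AbsolutelyContinuousOnInterval f a b := by
  unfold AbsolutelyContinuousOnInterval at hg ⊢
  have h0 := hg.const_mul C
  rw [mul_zero] at h0
  refine squeeze_zero' (Eventually.of_forall fun E => Finset.sum_nonneg fun i _ => dist_nonneg)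
    ?_ h0
  have : ∀ᶠ E in AbsolutelyContinuousOnInterval.totalLengthFilter ⊓
      𝓟 (AbsolutelyContinuousOnInterval.disjWithin a b),
      E ∈ AbsolutelyContinuousOnInterval.disjWithin a b :=
    mem_inf_of_right (mem_principal_self _)
  filter_upwards [this] with E hE
  rw [Finset.mul_sum]
  exact Finset.sum_le_sum fun i hi => h _ (hE.1 i hi).1 _ (hE.1 i hi).2

theorem ac_comp_contDiff {f g : ℝ → ℝ} {a b : ℝ} (hg : ContDiff ℝ 1 g)
    (hf : AbsolutelyContinuousOnInterval f a b) :
    AbsolutelyContinuousOnInterval (fun t => g (f t)) a b := by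
  obtain ⟨C, hC⟩ := hf.exists_bound
  obtain ⟨K, hK⟩ := (hg.contDiffOn (s := Icc (-C) C)).exists_lipschitzOnWith (by decide)
    (convex_Icc _ _) isCompact_Icc
  refine ac_of_dist_le (C := K) hf fun x hx y hy => ?_
  exact hK.dist_le_mul _ (abs_le.1 (hC x hx)) _ (abs_le.1 (hC y hy))

theorem ac_sub_le {f g : ℝ → ℝ} {t : ℝ} (ht : 0 ≤ t)
    (hf : AbsolutelyContinuousOnInterval f 0 t) (hg : IntervalIntegrable g volume 0 t)
    (h : ∀ᵐ x, x ∈ Ioo 0 t → deriv f x ≤ g x) : f t - f 0 ≤ ∫ x in (0:ℝ)..t, g x := by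
  rw [← hf.integral_deriv_eq_sub]
  refine intervalIntegral.integral_mono_ae_restrict ht hf.intervalIntegrable_deriv hg ?_
  rw [EventuallyLE, ← restrict_Ioo_eq_restrict_Icc, ae_restrict_iff' measurableSet_Ioo]
  exact h

theorem energy_core {H : Type*} [NormedAddCommGroup H] [InnerProductSpace ℝ H] [CompleteSpace H]
    {T : ℝ} (hT : 0 < T) (w' W : ℝ → H) (w0 : H) (hw' : IntervalIntegrable w' volume 0 T)
    (hW : ∀ t, W t = w0 + ∫ s in (0:ℝ)..t, w' s)
    (l m n : ℝ → ℝ) (hl : IntervalIntegrable l volume 0 T)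
    (hm : IntervalIntegrable m volume 0 T) (hn : IntervalIntegrable n volume 0 T)
    (hl0 : ∀ t, 0 ≤ l t) (hm0 : ∀ t, 0 ≤ m t) (hn0 : ∀ t, 0 ≤ n t)
    (h : ∀ᵐ t, t ∈ Ioo 0 T → ⟪W t, w' t⟫ + n t ≤ l t * ‖W t‖ ^ 2 + m t * ‖W t‖)
    (L M K : ℝ) (hL : L = ∫ s in (0:ℝ)..T, l s) (hM : M = ∫ s in (0:ℝ)..T, m s)
    (hK : K = Real.exp L * (‖w0‖ + M)) :
    ∫ s in (0:ℝ)..T, n s ≤ ‖w0‖ ^ 2 / 2 + K * (K * L + M) := by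
  have hsub : ∀ {t : ℝ}, t ∈ Icc 0 T → uIcc 0 t ⊆ uIcc 0 T := fun {t} ht => by
    rw [uIcc_of_le ht.1, uIcc_of_le hT.le]; exact Icc_subset_Icc_right ht.2
  have h0mem : (0:ℝ) ∈ uIcc 0 T := left_mem_uIcc
  have hW0 : W 0 = w0 := by simp [hW]
  -- absolute continuity of the norm
  have hφ : AbsolutelyContinuousOnInterval (fun t => ‖W t‖) 0 T := by
    refine ac_of_dist_le (C := 1)
      (hw'.norm.absolutelyContinuousOnInterval_intervalIntegral h0mem) fun x hx y hy => ?_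
    have ix : IntervalIntegrable w' volume 0 x :=
      hw'.mono_set (uIcc_subset_uIcc_left hx)
    have iy : IntervalIntegrable w' volume 0 y :=
      hw'.mono_set (uIcc_subset_uIcc_left hy)
    rw [Real.dist_eq, Real.dist_eq, one_mul,
      intervalIntegral.integral_interval_sub_left ix.norm iy.norm]
    refine (abs_norm_sub_norm_le _ _).trans ?_
    rw [hW, hW, add_sub_add_left_eq_sub, intervalIntegral.integral_interval_sub_left ix iy]
    exact intervalIntegral.norm_integral_le_abs_integral_norm
  have hq : AbsolutelyContinuousOnInterval (fun t => ‖W t‖ ^ 2) 0 T :=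
    ac_comp_contDiff (g := fun x => x ^ 2) (by fun_prop) hφ
  have hLac := hl.absolutelyContinuousOnInterval_intervalIntegral h0mem
  have hMac := hm.absolutelyContinuousOnInterval_intervalIntegral h0mem
  have hE : AbsolutelyContinuousOnInterval (fun t => Real.exp (-∫ s in (0:ℝ)..t, l s)) 0 T :=
    ac_comp_contDiff (g := fun x => Real.exp (-x)) (by fun_prop) hLac
  -- derivatives
  have hdW : ∀ᵐ t, t ∈ Ioo 0 T → HasDerivAt (fun t => ‖W t‖ ^ 2) (2 * ⟪W t, w' t⟫) t := by
    filter_upwards [hw'.ae_hasDerivAt_integral] with t ht htm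
    have h1 := (ht (by rw [uIcc_of_le hT.le]; exact Ioo_subset_Icc_self htm) 0 h0mem).const_add w0
    have h2 : W = fun t => w0 + ∫ s in (0:ℝ)..t, w' s := funext hW
    rw [← h2] at h1
    exact h1.norm_sq
  have hdl : ∀ᵐ t, t ∈ Ioo 0 T → HasDerivAt (fun t => ∫ s in (0:ℝ)..t, l s) (l t) t := by
    filter_upwards [hl.ae_hasDerivAt_integral] with t ht htm
    exact ht (by rw [uIcc_of_le hT.le]; exact Ioo_subset_Icc_self htm) 0 h0mem
  have hL0 : 0 ≤ L := hL ▸ intervalIntegral.integral_nonneg hT.le fun t _ => hl0 t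
  have hM0 : 0 ≤ M := hM ▸ intervalIntegral.integral_nonneg hT.le fun t _ => hm0 t
  have hK0 : 0 ≤ K := by rw [hK]; positivity
  -- Gronwall, regularized
  have hG : ∀ t ∈ Icc 0 T, ∀ ε > (0:ℝ), ‖W t‖ ≤ Real.exp L * (‖w0‖ + ε + M) := by
    intro t ht ε hε
    have hpos : ∀ x : ℝ, 0 < x ^ 2 + ε ^ 2 := fun x => by positivity
    have hψ : AbsolutelyContinuousOnInterval (fun t => Real.sqrt (‖W t‖ ^ 2 + ε ^ 2)) 0 T :=
      ac_comp_contDiff (g := fun x => Real.sqrt (x ^ 2 + ε ^ 2))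
        (ContDiff.sqrt (by fun_prop) fun x => (hpos x).ne') hφ
    have key := ac_sub_le (g := m) ht.1 ((hψ.fun_mul hE).mono (hsub ht))
      (hm.mono_set (hsub ht)) ?_
    · simp only [hW0, intervalIntegral.integral_same, neg_zero, Real.exp_zero, mul_one] at key
      have hlt : ∫ s in (0:ℝ)..t, l s ≤ L := hL ▸
        intervalIntegral.integral_mono_interval le_rfl ht.1 ht.2
          (Eventually.of_forall fun s => hl0 s) hl
      have hmt : ∫ s in (0:ℝ)..t, m s ≤ M := hM ▸
        intervalIntegral.integral_mono_interval le_rfl ht.1 ht.2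
          (Eventually.of_forall fun s => hm0 s) hm
      have h1 : ‖W t‖ ≤ Real.sqrt (‖W t‖ ^ 2 + ε ^ 2) :=
        Real.le_sqrt_of_sq_le (by nlinarith)
      have h2 : Real.sqrt (‖w0‖ ^ 2 + ε ^ 2) ≤ ‖w0‖ + ε :=
        Real.sqrt_le_iff.2 ⟨by positivity, by nlinarith [norm_nonneg w0]⟩
      have h3 : ‖W t‖ * Real.exp (-L) ≤ ‖w0‖ + ε + M := by
        have : ‖W t‖ * Real.exp (-L) ≤ Real.sqrt (‖W t‖ ^ 2 + ε ^ 2) *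
          Real.exp (-∫ s in (0:ℝ)..t, l s) := by gcongr
        linarith
      calc ‖W t‖ = Real.exp L * (‖W t‖ * Real.exp (-L)) := by
            rw [mul_left_comm, ← Real.exp_add]; simp
        _ ≤ _ := by gcongr
    · filter_upwards [hdW, hdl, h] with s h1 h2 h3 hs
      have hs' : s ∈ Ioo 0 T := ⟨hs.1, hs.2.trans_le ht.2⟩
      have d1 := ((h1 hs').add_const (ε ^ 2)).sqrt (hpos _).ne'
      have d2 := (h2 hs').fun_neg.exp
      rw [(d1.fun_mul d2).deriv]
      set ψ := Real.sqrt (‖W s‖ ^ 2 + ε ^ 2) with hψd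
      have hψ0 : 0 < ψ := Real.sqrt_pos.2 (hpos _)
      have hψ1 : ‖W s‖ ≤ ψ := Real.le_sqrt_of_sq_le (by nlinarith)
      have h4 : 2 * ⟪W s, w' s⟫ / (2 * ψ) ≤ l s * ψ + m s := by
        rw [div_le_iff₀ (by positivity)]
        have a1 := mul_le_mul_of_nonneg_left hψ1 (hm0 s)
        have a2 := mul_le_mul_of_nonneg_left (pow_le_pow_left₀ (norm_nonneg _) hψ1 2) (hl0 s)
        nlinarith [h3 hs', hn0 s]
      set e := Real.exp (-∫ s in (0:ℝ)..s, l s) with he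
      have he0 : 0 < e := Real.exp_pos _
      have he1 : e ≤ 1 := Real.exp_le_one_iff.2
        (neg_nonpos.2 (intervalIntegral.integral_nonneg hs.1.le fun t _ => hl0 t))
      have a3 := mul_le_mul_of_nonneg_right h4 he0.le
      have a4 := mul_le_mul_of_nonneg_left he1 (hm0 s)
      nlinarith
  have hbd : ∀ t ∈ Icc 0 T, ‖W t‖ ≤ K := by
    intro t ht
    refine le_of_forall_pos_le_add fun δ hδ => ?_
    have := hG t ht (δ / Real.exp L) (by positivity)
    refine this.trans (le_of_eq ?_)
    rw [hK]; field_simp; ring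
  -- final integration
  have i1 := (hl.const_mul (K ^ 2)).add (hm.const_mul K)
  have fin := ac_sub_le hT.le hq ((i1.sub hn).const_mul 2) (by
    filter_upwards [hdW, h] with s h1 h3 hs
    rw [(h1 hs).deriv]
    have hb := hbd s (Ioo_subset_Icc_self hs)
    have a1 := mul_le_mul_of_nonneg_left hb (hm0 s)
    have a2 := mul_le_mul_of_nonneg_left (pow_le_pow_left₀ (norm_nonneg _) hb 2) (hl0 s)
    have := h3 hs
    nlinarith)
  rw [intervalIntegral.integral_const_mul] at fin
  have e1 := intervalIntegral.integral_sub i1 hn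
  have e2 := intervalIntegral.integral_add (hl.const_mul (K ^ 2)) (hm.const_mul K)
  rw [intervalIntegral.integral_const_mul, intervalIntegral.integral_const_mul, ← hL, ← hM] at e2
  rw [e1, e2, hW0] at fin
  nlinarith [sq_nonneg ‖W T‖]

/-- a priori `L²(0,T;V)`-bound for Galerkin solutions: with
`K₁ = e^{‖ℓ‖_{L¹}} (‖u_{N,0}‖_H + ‖α‖_{L¹})` one has
`c_a ∫₀ᵀ ‖u_N(t)‖_V² dt ≤ ‖u_{N,0}‖_H²/2 + K₁ (K₁ ‖ℓ‖_{L¹} + ‖α‖_{L¹})`. -/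
theorem stmt_6
    {V H : Type*}
    [NormedAddCommGroup V] [InnerProductSpace ℝ V] [CompleteSpace V]
    [TopologicalSpace.SeparableSpace V]
    [NormedAddCommGroup H] [InnerProductSpace ℝ H] [CompleteSpace H]
    [TopologicalSpace.SeparableSpace H]
    (ι : V →L[ℝ] H) (hι_inj : Function.Injective ι) (hι_dense : DenseRange ι)
    (hι_cpt : IsCompactOperator ι)
    (T : ℝ) (hT : 0 < T)
    (F : ℝ → V → Set H)
    (hF : ∀ t ∈ Icc (0:ℝ) T, ∀ v : V, (F t v).Nonempty ∧ IsClosed (F t v) ∧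
      Bornology.IsBounded (F t v) ∧ Convex ℝ (F t v))
    -- (A1)
    (a : V →ₗ[ℝ] V →ₗ[ℝ] ℝ) (ca Ca : ℝ) (hca : 0 < ca) (hCa : 0 < Ca)
    (hcoer : ∀ v : V, ca * ‖v‖ ^ 2 ≤ a v v)
    (habd : ∀ v w : V, a v w ≤ Ca * ‖v‖ * ‖w‖)
    -- (A3)
    (α : ℝ → ℝ) (hα : IntegrableOn α (Ioo 0 T)) (cF : ℝ) (hcF : 0 < cF)
    (hA3 : ∀ᵐ t ∂volume.restrict (Ioo (0:ℝ) T),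
      (∀ f ∈ F t 0, ‖f‖ ≤ α t) ∧
      ∀ u v : V, hausdorffDist (F t u) (F t v) ≤ cF * (1 + ‖u‖ + ‖v‖) * ‖ι u - ι v‖)
    -- (A4)
    (ℓ : ℝ → ℝ) (hℓ : IntegrableOn ℓ (Ioo 0 T))
    (hA4 : ∀ᵐ t ∂volume.restrict (Ioo (0:ℝ) T), ∀ v v2 : V, ∀ g ∈ F t v,
      ∃ g' ∈ F t v2, ⟪g - g', ι v - ι v2⟫ ≤ ℓ t * ‖ι v - ι v2‖ ^ 2)
    -- Galerkin data
    (VN : Submodule ℝ V) (hVNfd : FiniteDimensional ℝ VN)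
    (uN0 : V) (huN0 : uN0 ∈ VN)
    (uN uN' : ℝ → V)
    (huNmem : ∀ t ∈ Icc (0:ℝ) T, uN t ∈ VN)
    (huN'mem : ∀ᵐ t ∂volume.restrict (Ioo (0:ℝ) T), uN' t ∈ VN)
    (huN'int : IntegrableOn uN' (Ioo 0 T))
    (hFTC : ∀ t ∈ Icc (0:ℝ) T, uN t = uN 0 + ∫ s in (0:ℝ)..t, uN' s)
    (hinit : uN 0 = uN0)
    (fN : ℝ → H) (hfN : IntegrableOn fN (Ioo 0 T))
    (heq : ∀ᵐ t ∂volume.restrict (Ioo (0:ℝ) T), ∀ v ∈ VN,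
      ⟪ι (uN' t), ι v⟫ + a (uN t) v = ⟪fN t, ι v⟫)
    (hincl : ∀ᵐ t ∂volume.restrict (Ioo (0:ℝ) T), fN t ∈ F t (uN t)) :
    ca * (∫ t in Ioo (0:ℝ) T, ‖uN t‖ ^ 2) ≤
      ‖ι uN0‖ ^ 2 / 2 +
        (Real.exp (∫ τ in Ioo (0:ℝ) T, |ℓ τ|) * (‖ι uN0‖ + (∫ τ in Ioo (0:ℝ) T, |α τ|))) *
          ((Real.exp (∫ τ in Ioo (0:ℝ) T, |ℓ τ|) * (‖ι uN0‖ + (∫ τ in Ioo (0:ℝ) T, |α τ|))) *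
              (∫ τ in Ioo (0:ℝ) T, |ℓ τ|) +
            (∫ τ in Ioo (0:ℝ) T, |α τ|)) := by
  have ii : ∀ {E : Type _} [NormedAddCommGroup E] {f : ℝ → E}, IntegrableOn f (Ioo 0 T) →
      IntervalIntegrable f volume 0 T := fun hf => by
    rw [intervalIntegrable_iff_integrableOn_Ioo_of_le hT.le]; exact hf
  have hu' : IntervalIntegrable uN' volume 0 T := by
    rw [intervalIntegrable_iff_integrableOn_Ioo_of_le hT.le]; exact huN'int
  have hcont : ContinuousOn uN (Icc 0 T) := by
    have h1 := intervalIntegral.continuousOn_primitive_interval'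
      hu' (left_mem_uIcc : (0:ℝ) ∈ uIcc 0 T)
    rw [uIcc_of_le hT.le] at h1
    exact (continuousOn_const.add h1).congr hFTC
  have hn : IntervalIntegrable (fun t => ca * ‖uN t‖ ^ 2) volume 0 T := by
    refine ContinuousOn.intervalIntegrable ?_
    rw [uIcc_of_le hT.le]
    exact continuousOn_const.mul (hcont.norm.pow 2)
  have hw' : IntervalIntegrable (fun t => ι (uN' t)) volume 0 T := by
    rw [intervalIntegrable_iff_integrableOn_Ioo_of_le hT.le]
    exact ι.integrable_comp huN'int
  have hWeq : ∀ t ∈ Icc (0:ℝ) T, ι uN0 + ∫ s in (0:ℝ)..t, ι (uN' s) = ι (uN t) := by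
    intro t ht
    rw [hFTC t ht, hinit, map_add, ι.intervalIntegral_comp_comm]
    refine hu'.mono_set ?_
    rw [uIcc_of_le ht.1, uIcc_of_le hT.le]; exact Icc_subset_Icc_right ht.2
  have conv : ∀ f : ℝ → ℝ, ∫ s in (0:ℝ)..T, f s = ∫ s in Ioo (0:ℝ) T, f s := fun f => by
    rw [intervalIntegral.integral_of_le hT.le, integral_Ioc_eq_integral_Ioo]
  have main := energy_core hT (fun t => ι (uN' t))
    (fun t => ι uN0 + ∫ s in (0:ℝ)..t, ι (uN' s)) (ι uN0) hw' (fun t => rfl)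
    (fun t => |ℓ t|) (fun t => |α t|) (fun t => ca * ‖uN t‖ ^ 2)
    (ii hℓ).abs (ii hα).abs hn (fun _ => abs_nonneg _) (fun _ => abs_nonneg _)
    (fun _ => by positivity) (by
      rw [← ae_restrict_iff' measurableSet_Ioo]
      filter_upwards [hA3, hA4, heq, hincl, ae_restrict_mem measurableSet_Ioo]
        with t h3 h4 he hi htm
      have htc := Ioo_subset_Icc_self htm
      simp only [hWeq t htc]
      obtain ⟨g, hg, hgl⟩ := h4 (uN t) 0 (fN t) hi
      have e := he (uN t) (huNmem t htc)
      have c := hcoer (uN t)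
      have hgn := h3.1 g hg
      simp only [map_zero, sub_zero, inner_sub_left] at hgl
      have cs := real_inner_le_norm g (ι (uN t))
      rw [real_inner_comm]
      have b1 : ‖g‖ * ‖ι (uN t)‖ ≤ |α t| * ‖ι (uN t)‖ := by
        gcongr; exact hgn.trans (le_abs_self _)
      have b2 : ℓ t * ‖ι (uN t)‖ ^ 2 ≤ |ℓ t| * ‖ι (uN t)‖ ^ 2 := by
        gcongr; exact le_abs_self _
      linarith) _ _ _ rfl rfl rfl
  simp only [conv] at main
  rw [integral_const_mul] at main
  exact main
end

section
/- Assume (A1)–(A4) below and let V_N ⊆ V be a finite-dimensional subspace. Define A_N : V_N → V_N by (A_N v, w) = a(v,w) for all v,w ∈ V_N. Let v_N : [0,T] → V_N be absolutely continuous, let u_{N,0} ∈ V_N, and let δ_N ∈ L¹(0,T) satisfy dist(v_N'(t) + A_N v_N(t), F(t,v_N(t)))_H ≤ δ_N(t) for a.e. t ∈ (0,T). Then there exists an absolutely continuous u_N : [0,T] → V_N with u_N(0) = u_{N,0} and an f_N ∈ L¹(0,T;H) with (u_N'(t),v) + a(u_N(t),v) = (f_N(t),v) for all v ∈ V_N and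 f_N(t) ∈ F(t,u_N(t)) for a.e. t ∈ (0,T), such that, with C_ℓ := sup_{0≤s≤t≤T} exp(∫_s^t ℓ(τ) dτ) and ℓ₊(t) := max(0,ℓ(t)): (i) sup_{t∈[0,T]} ‖v_N(t) − u_N(t)‖_H ≤ C_ℓ·(‖v_N(0) − u_{N,0}‖_H + ‖δ_N‖_{L¹(0,T)}); (ii) c_a·∫₀ᵀ‖v_N(t)−u_N(t)‖_V² dt ≤ ‖δ_N‖_{L¹(0,T)}·sup_{t∈[0,T]}‖v_N(t)−u_N(t)‖_H + ‖ℓ₊‖_{L¹(0,T)}·(sup_{t∈[0,T]}‖v_N(t)−u_N(t)‖_H)² + ‖v_N(0)−u_{N,0}‖_H². -/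
open MeasureTheory Set Filter Metric
open scoped RealInnerProductSpace

section Proj
variable {H : Type*} [NormedAddCommGroup H] [InnerProductSpace ℝ H]

open Classical in
/-- metric projection onto a closed convex set (junk value `0` otherwise) -/
noncomputable def nproj (C : Set H) (y : H) : H :=
  if h : ∃ x ∈ C, ∀ z ∈ C, ⟪y - x, z - x⟫ ≤ 0 then h.choose else 0

theorem nproj_spec [CompleteSpace H] {C : Set H} (h1 : C.Nonempty) (h2 : IsClosed C)
    (h3 : Convex ℝ C) (y : H) :
    nproj C y ∈ C ∧ ∀ z ∈ C, ⟪y - nproj C y, z - nproj C y⟫ ≤ 0 := by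
  have h : ∃ x ∈ C, ∀ z ∈ C, ⟪y - x, z - x⟫ ≤ 0 := by
    obtain ⟨v, hv, he⟩ := exists_norm_eq_iInf_of_complete_convex h1 h2.isComplete h3 y
    exact ⟨v, hv, (norm_eq_iInf_iff_real_inner_le_zero h3 hv).1 he⟩
  have := h.choose_spec
  unfold nproj
  rw [dif_pos h]
  exact this

theorem nproj_sq [CompleteSpace H] {C : Set H} (h1 : C.Nonempty) (h2 : IsClosed C)
    (h3 : Convex ℝ C) (y z : H) (hz : z ∈ C) :
    ‖z - nproj C y‖ ^ 2 + ‖y - nproj C y‖ ^ 2 ≤ ‖z - y‖ ^ 2 := by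
  have h := (nproj_spec h1 h2 h3 y).2 z hz
  have e : z - y = (z - nproj C y) - (y - nproj C y) := by abel
  rw [e, norm_sub_sq_real (z - nproj C y), real_inner_comm (y - nproj C y) (z - nproj C y)]
  linarith

theorem nproj_dist [CompleteSpace H] {C : Set H} (h1 : C.Nonempty) (h2 : IsClosed C)
    (h3 : Convex ℝ C) (y : H) : ‖y - nproj C y‖ = infDist y C := by
  apply le_antisymm
  · rw [le_infDist h1]
    intro z hz
    have := nproj_sq h1 h2 h3 y z hz
    rw [dist_comm, dist_eq_norm]
    apply le_of_sq_le_sq _ (norm_nonneg _)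
    nlinarith [sq_nonneg ‖z - nproj C y‖]
  · rw [← dist_eq_norm]
    exact infDist_le_dist_of_mem (nproj_spec h1 h2 h3 y).1

theorem nproj_lip [CompleteSpace H] {C : Set H} (h1 : C.Nonempty) (h2 : IsClosed C)
    (h3 : Convex ℝ C) (y y' : H) : ‖nproj C y - nproj C y'‖ ≤ ‖y - y'‖ := by
  have a1 := (nproj_spec h1 h2 h3 y).2 _ (nproj_spec h1 h2 h3 y').1
  have a2 := (nproj_spec h1 h2 h3 y').2 _ (nproj_spec h1 h2 h3 y).1
  set p := nproj C y
  set q := nproj C y'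
  have h : ‖p - q‖ ^ 2 ≤ ⟪y - y', p - q⟫ := by
    have e : ⟪y - y', p - q⟫ = ‖p - q‖ ^ 2 - ⟪y - p, q - p⟫ - ⟪y' - q, p - q⟫ := by
      rw [← real_inner_self_eq_norm_sq]
      simp only [inner_sub_left, inner_sub_right]
      ring
    linarith
  have h2 := real_inner_le_norm (y - y') (p - q)
  by_contra hc
  push Not at hc
  have : 0 < ‖p - q‖ := lt_of_le_of_lt (norm_nonneg _) hc
  nlinarith

theorem nproj_haus [CompleteSpace H] {C D : Set H} (h1 : C.Nonempty) (h2 : IsClosed C)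
    (h3 : Convex ℝ C) (k1 : D.Nonempty) (k2 : IsClosed D)
    (k3 : Convex ℝ D) (y : H) (η : ℝ) (hη : hausdorffDist C D < η)
    (htop : hausdorffEDist C D ≠ ⊤) :
    ‖nproj C y - nproj D y‖ ≤
      η + √(4 * η * ‖y - nproj C y‖ + 4 * η ^ 2) := by
  have hη0 : 0 < η := lt_of_le_of_lt hausdorffDist_nonneg hη
  obtain ⟨d, hd, hd'⟩ := exists_dist_lt_of_hausdorffDist_lt (nproj_spec h1 h2 h3 y).1 hη htop
  obtain ⟨c, hc, hc'⟩ := exists_dist_lt_of_hausdorffDist_lt' (nproj_spec k1 k2 k3 y).1 hη htop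
  have b1 := nproj_sq h1 h2 h3 y c hc
  have b2 : ‖y - nproj D y‖ ≤ ‖y - nproj C y‖ + η := by
    rw [nproj_dist k1 k2 k3]
    refine (infDist_le_dist_of_mem hd).trans ?_
    rw [← dist_eq_norm]
    refine (dist_triangle _ (nproj C y) _).trans ?_
    gcongr
  rw [dist_eq_norm] at hc'
  have b3 : ‖c - y‖ ≤ ‖y - nproj C y‖ + 2 * η := by
    have : ‖c - y‖ ≤ ‖c - nproj D y‖ + ‖nproj D y - y‖ := norm_sub_le_norm_sub_add_norm_sub _ _ _
    rw [norm_sub_rev (nproj D y) y] at this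
    linarith
  have b4 : ‖c - nproj C y‖ ≤ √(4 * η * ‖y - nproj C y‖ + 4 * η ^ 2) := by
    apply Real.le_sqrt_of_sq_le
    have := pow_le_pow_left₀ (norm_nonneg _) b3 2
    nlinarith
  have : ‖nproj C y - nproj D y‖ ≤ ‖nproj C y - c‖ + ‖c - nproj D y‖ :=
    norm_sub_le_norm_sub_add_norm_sub _ _ _
  rw [norm_sub_rev _ c] at this
  linarith

theorem nproj_tendsto [CompleteSpace H] {C : Set H} (h1 : C.Nonempty) (h2 : IsClosed C)
    (h3 : Convex ℝ C) (hb : Bornology.IsBounded C) (D : ℕ → Set H) (k1 : ∀ n, (D n).Nonempty)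
    (k2 : ∀ n, IsClosed (D n))
    (k3 : ∀ n, Convex ℝ (D n)) (kb : ∀ n, Bornology.IsBounded (D n)) (y : H) (z : ℕ → H)
    (hz : Tendsto z atTop (nhds y))
    (hD : Tendsto (fun n => hausdorffDist C (D n)) atTop (nhds 0)) :
    Tendsto (fun n => nproj (D n) (z n)) atTop (nhds (nproj C y)) := by
  rw [tendsto_iff_norm_sub_tendsto_zero]
  have hη : Tendsto (fun n => hausdorffDist C (D n) + 1 / ((n : ℝ) + 1)) atTop (nhds 0) := by
    simpa using hD.add tendsto_one_div_add_atTop_nhds_zero_nat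
  have hcont : Continuous fun η : ℝ => η + √(4 * η * ‖y - nproj C y‖ + 4 * η ^ 2) := by fun_prop
  have h4 := (hcont.tendsto 0).comp hη
  have h5 := (tendsto_iff_norm_sub_tendsto_zero.1 hz).add h4
  simp only [Function.comp_def] at h5
  have e : (0 : ℝ) + (0 + √(4 * 0 * ‖y - nproj C y‖ + 4 * 0 ^ 2)) = 0 := by simp
  rw [e] at h5
  refine squeeze_zero (fun n => norm_nonneg _) (fun n => ?_) h5
  have c1 := nproj_lip (k1 n) (k2 n) (k3 n) (z n) y
  have c2 := nproj_haus h1 h2 h3 (k1 n) (k2 n) (k3 n) y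
    (hausdorffDist C (D n) + 1 / ((n : ℝ) + 1)) (by have : (0:ℝ) < 1 / ((n : ℝ) + 1) := by positivity
                                                    linarith)
    (hausdorffEDist_ne_top_of_nonempty_of_bounded h1 (k1 n) hb (kb n))
  rw [norm_sub_rev] at c2
  have := norm_sub_le_norm_sub_add_norm_sub (nproj (D n) (z n)) (nproj (D n) y) (nproj C y)
  linarith

/-- measurability of the projection onto a measurable multifunction, fixed point -/
theorem nproj_meas [CompleteSpace H] [TopologicalSpace.SeparableSpace H]
    [MeasurableSpace H] [BorelSpace H] (S : Set ℝ) (hS : MeasurableSet S) (C : ℝ → Set H)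
    (hC : ∀ t ∈ S, (C t).Nonempty ∧ IsClosed (C t) ∧ Convex ℝ (C t))
    (hm : ∀ M : Set H, IsOpen M → MeasurableSet {t | t ∈ S ∧ (C t ∩ M).Nonempty}) (y : H) :
    Measurable (S.indicator fun t => nproj (C t) y) := by
  have hball : ∀ (x : H) (r : ℝ), MeasurableSet {t | t ∈ S ∧ nproj (C t) y ∈ ball x r} := by
    intro x r
    have e : {t | t ∈ S ∧ nproj (C t) y ∈ ball x r} =
        ⋃ ρ : {ρ : ℚ // (ρ : ℝ) < r}, ⋂ q : ℚ,
          ((S \ {t | t ∈ S ∧ (C t ∩ ball y q).Nonempty}) ∪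
            {t | t ∈ S ∧ (C t ∩ (ball y q ∩ ball x (ρ : ℚ))).Nonempty}) := by
      ext t
      simp only [mem_ofPred_eq, mem_iUnion, mem_iInter, mem_union, Set.mem_sdiff, Subtype.exists]
      constructor
      · rintro ⟨ht, hb⟩
        obtain ⟨a1, a2, a3⟩ := hC t ht
        obtain ⟨ρ, h1, h2⟩ := exists_rat_btwn (mem_ball.1 hb)
        refine ⟨ρ, h2, fun q => ?_⟩
        by_cases hq : (C t ∩ ball y q).Nonempty
        · right
          refine ⟨ht, nproj (C t) y, (nproj_spec a1 a2 a3 y).1, ?_, h1⟩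
          obtain ⟨c, hc, hcq⟩ := hq
          rw [mem_ball, dist_comm, dist_eq_norm, nproj_dist a1 a2 a3]
          refine (infDist_le_dist_of_mem hc).trans_lt ?_
          rwa [dist_comm]
        · left
          exact ⟨ht, fun h => hq h.2⟩
      · rintro ⟨ρ, hρ, h⟩
        have ht : t ∈ S := by
          rcases h 0 with h | h
          · exact h.1
          · exact h.1
        obtain ⟨a1, a2, a3⟩ := hC t ht
        refine ⟨ht, ?_⟩
        rw [mem_ball]
        refine lt_of_le_of_lt ?_ hρ
        set d := ‖y - nproj (C t) y‖
        apply le_of_forall_pos_le_add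
        intro ε hε
        obtain ⟨q, hq1, hq2⟩ := exists_rat_btwn
          (show d < √(d ^ 2 + ε ^ 2) from Real.lt_sqrt_of_sq_lt (by nlinarith [pow_pos hε 2]))
        rcases h q with h | h
        · exfalso
          refine h.2 ⟨ht, nproj (C t) y, (nproj_spec a1 a2 a3 y).1, ?_⟩
          rwa [mem_ball, dist_comm, dist_eq_norm]
        · obtain ⟨-, c, hc, hc1, hc2⟩ := h
          have := nproj_sq a1 a2 a3 y c hc
          rw [mem_ball, dist_eq_norm] at hc1
          have hd0 : 0 ≤ d := norm_nonneg _
          have hc3 : ‖c - y‖ ^ 2 ≤ d ^ 2 + ε ^ 2 := by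
            have := (hc1.trans hq2).le
            calc ‖c - y‖ ^ 2 ≤ (√(d ^ 2 + ε ^ 2)) ^ 2 := by gcongr
              _ = _ := Real.sq_sqrt (by positivity)
          have hc4 : ‖c - nproj (C t) y‖ ≤ ε := by
            apply le_of_sq_le_sq _ hε.le
            change ‖c - nproj (C t) y‖ ^ 2 + d ^ 2 ≤ _ at this
            linarith
          have := dist_triangle (nproj (C t) y) c x
          rw [mem_ball] at hc2
          rw [dist_comm (nproj (C t) y) c, dist_eq_norm c (nproj (C t) y)] at this
          linarith
    rw [e]
    refine MeasurableSet.iUnion fun ρ => MeasurableSet.iInter fun q => ?_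
    exact (hS.diff (hm _ isOpen_ball)).union (hm _ (isOpen_ball.inter isOpen_ball))
  have : SecondCountableTopology H := UniformSpace.secondCountable_of_separable H
  have hopen : ∀ U : Set H, IsOpen U → MeasurableSet {t | t ∈ S ∧ nproj (C t) y ∈ U} := by
    intro U hU
    choose! r hr hrU using fun x (hx : x ∈ U) => Metric.isOpen_iff.1 hU x hx
    obtain ⟨s, hs, hsc⟩ := TopologicalSpace.isOpen_biUnion_countable U (fun x => ball x (r x))
      (fun x _ => isOpen_ball)
    obtain ⟨hsc, hse⟩ := hsc
    have hU2 : U = ⋃ x ∈ s, ball x (r x) := by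
      rw [hse]
      ext z
      simp only [mem_iUnion]
      constructor
      · intro hz
        exact ⟨z, hz, mem_ball_self (hr z hz)⟩
      · rintro ⟨x, hx, hz⟩
        exact hrU x hx hz
    have : {t | t ∈ S ∧ nproj (C t) y ∈ U} = ⋃ x ∈ s, {t | t ∈ S ∧ nproj (C t) y ∈ ball x (r x)} := by
      ext t
      rw [hU2]
      simp only [mem_ofPred_eq, mem_iUnion]
      tauto
    rw [this]
    exact MeasurableSet.biUnion hsc fun x _ => hball x _
  have hr : Measurable (fun t : S => nproj (C t) y) := by
    apply measurable_of_isOpen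
    intro U hU
    have : (fun t : S => nproj (C t) y) ⁻¹' U = Subtype.val ⁻¹' {t | t ∈ S ∧ nproj (C t) y ∈ U} := by
      ext t
      simp
    rw [this]
    exact measurable_subtype_coe (hopen U hU)
  apply measurable_of_restrict_of_restrict_compl hS
  · convert hr using 1
    ext t
    simp
  · convert (measurable_const : Measurable fun _ : (Sᶜ : Set ℝ) => (0 : H)) using 1
    ext t
    have := t.2
    simp [indicator]
    intro h
    exact absurd h t.2
end Proj


theorem sel_meas {E H : Type*} [NormedAddCommGroup E]
    [NormedAddCommGroup H] [InnerProductSpace ℝ H] [CompleteSpace H]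
    [TopologicalSpace.SeparableSpace H] (T : ℝ) (F : ℝ → E → Set H)
    (hF : ∀ t ∈ Icc (0:ℝ) T, ∀ v : E, (F t v).Nonempty ∧ IsClosed (F t v) ∧
      Bornology.IsBounded (F t v) ∧ Convex ℝ (F t v))
    (hFmeas : ∀ v : E, ∀ M : Set H, IsOpen M →
      MeasurableSet {t | t ∈ Icc (0:ℝ) T ∧ (F t v ∩ M).Nonempty})
    (hFcont : ∀ᵐ t ∂volume.restrict (Ioo (0:ℝ) T), ∀ v : E, ∀ vk : ℕ → E,
      Tendsto vk atTop (nhds v) →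
      Tendsto (fun k => hausdorffDist (F t v) (F t (vk k))) atTop (nhds 0))
    (w : ℝ → E) (y : ℝ → H)
    (hw : AEStronglyMeasurable w (volume.restrict (Ioo (0:ℝ) T)))
    (hy : AEStronglyMeasurable y (volume.restrict (Ioo (0:ℝ) T))) :
    AEStronglyMeasurable (fun t => nproj (F t (w t)) (y t)) (volume.restrict (Ioo (0:ℝ) T)) := by
  borelize H
  have : SecondCountableTopology H := UniformSpace.secondCountable_of_separable H
  have hwy := hw.prodMk hy
  obtain ⟨g, hg, hge⟩ := hwy
  set s := hg.approx
  have h1 : ∀ n, AEStronglyMeasurable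
      (fun t => (Icc (0:ℝ) T).indicator (fun t => nproj (F t (s n t).1) (s n t).2) t)
      (volume.restrict (Ioo (0:ℝ) T)) := by
    intro n
    have := SimpleFunc.measurable_bind (s n)
      (fun (x : E × H) t => (Icc (0:ℝ) T).indicator (fun t => nproj (F t x.1) x.2) t)
      (fun x => nproj_meas (Icc (0:ℝ) T) measurableSet_Icc (fun t => F t x.1)
        (fun t ht => ⟨(hF t ht x.1).1, (hF t ht x.1).2.1, (hF t ht x.1).2.2.2⟩) (hFmeas x.1) x.2)
    exact this.stronglyMeasurable.aestronglyMeasurable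
  refine aestronglyMeasurable_of_tendsto_ae atTop h1 ?_
  filter_upwards [hge, hFcont, ae_restrict_mem measurableSet_Ioo] with t h2 h3 ht
  have ht' : t ∈ Icc (0:ℝ) T := Ioo_subset_Icc_self ht
  simp only [indicator_of_mem ht']
  have h4 := hg.tendsto_approx t
  rw [← h2] at h4
  have h5 := (continuous_fst.tendsto _).comp h4
  have h6 := (continuous_snd.tendsto _).comp h4
  refine nproj_tendsto (hF t ht' _).1 (hF t ht' _).2.1 (hF t ht' _).2.2.2 (hF t ht' _).2.2.1 _
    (fun n => (hF t ht' _).1) (fun n => (hF t ht' _).2.1) (fun n => (hF t ht' _).2.2.2)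
    (fun n => (hF t ht' _).2.2.1) _ _ h6 (h3 _ _ h5)

/-- minimal norm / Mazur lemma in Hilbert space -/
theorem hilbert_mazur {X : Type*} [NormedAddCommGroup X] [InnerProductSpace ℝ X] [CompleteSpace X]
    (x : ℕ → X) (M : ℝ) (hM : ∀ k, ‖x k‖ ≤ M) :
    ∃ (y : ℕ → X) (z : X), (∀ n, y n ∈ convexHull ℝ (x '' Ici n)) ∧ Tendsto y atTop (nhds z) := by
  set C : ℕ → Set X := fun n => convexHull ℝ (x '' Ici n) with hCdef
  have hxC : ∀ n, x n ∈ C n := fun n => subset_convexHull ℝ _ ⟨n, self_mem_Ici, rfl⟩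
  have hCne : ∀ n, (C n).Nonempty := fun n => ⟨x n, hxC n⟩
  have hCanti : ∀ m n, m ≤ n → C n ⊆ C m := fun m n h =>
    convexHull_mono (image_mono (Ici_subset_Ici.2 h))
  set d : ℕ → ℝ := fun n => infDist 0 (C n)
  have hd0 : ∀ n, 0 ≤ d n := fun n => infDist_nonneg
  have hmono : Monotone d := fun m n h => infDist_le_infDist_of_subset (hCanti m n h) (hCne n)
  have hdM : ∀ n, d n ≤ M := fun n => by
    refine (infDist_le_dist_of_mem (hxC n)).trans ?_
    rw [dist_zero_left]; exact hM n
  have hlim := tendsto_atTop_ciSup hmono ⟨M, by rintro _ ⟨n, rfl⟩; exact hdM n⟩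
  set D := ⨆ n, d n
  have hdD : ∀ n, d n ≤ D := hmono.ge_of_tendsto hlim
  have hy : ∀ n : ℕ, ∃ y ∈ C n, ‖y‖ < d n + 1 / ((n : ℝ) + 1) := by
    intro n
    have h : infDist 0 (C n) < d n + 1 / ((n : ℝ) + 1) := by
      have : (0:ℝ) < 1 / ((n : ℝ) + 1) := by positivity
      change d n < _
      linarith
    obtain ⟨y, hy, h⟩ := (infDist_lt_iff (hCne n)).1 h
    exact ⟨y, hy, by rwa [dist_zero_left] at h⟩
  choose y hyC hyn using hy
  have hcau : CauchySeq y := by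
    have key : ∀ n m, n ≤ m → ‖y n - y m‖ ^ 2 ≤ 4 * (D + 1 / ((n : ℝ) + 1)) ^ 2 - 4 * (d n) ^ 2 := by
      intro n m hnm
      have e1 : ‖y n‖ ≤ D + 1 / ((n : ℝ) + 1) := (hyn n).le.trans (by gcongr; exact hdD n)
      have e2 : ‖y m‖ ≤ D + 1 / ((n : ℝ) + 1) := (hyn m).le.trans (by gcongr; exact hdD m)
      have e3 : d n ≤ ‖(1/2 : ℝ) • y n + (1/2 : ℝ) • y m‖ := by
        rw [← dist_zero_left]
        apply infDist_le_dist_of_mem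
        exact (convex_convexHull ℝ _) (hyC n) (hCanti n m hnm (hyC m)) (by norm_num) (by norm_num)
          (by norm_num)
      have e4 : ‖(1/2 : ℝ) • y n + (1/2 : ℝ) • y m‖ = 1/2 * ‖y n + y m‖ := by
        rw [← smul_add, norm_smul]; norm_num
      have e5 := parallelogram_law_with_norm ℝ (y n) (y m)
      have e6 : ‖y n‖ ^ 2 ≤ (D + 1 / ((n : ℝ) + 1)) ^ 2 := by gcongr
      have e7 : ‖y m‖ ^ 2 ≤ (D + 1 / ((n : ℝ) + 1)) ^ 2 := by gcongr
      have e8 : (2 * d n) ^ 2 ≤ ‖y n + y m‖ ^ 2 := by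
        have := hd0 n
        gcongr
        linarith
      nlinarith
    have hb : Tendsto (fun n : ℕ => √(4 * (D + 1 / ((n : ℝ) + 1)) ^ 2 - 4 * (d n) ^ 2)) atTop (nhds 0) := by
      have h1 : Tendsto (fun n : ℕ => 4 * (D + 1 / ((n : ℝ) + 1)) ^ 2 - 4 * (d n) ^ 2) atTop
          (nhds (4 * (D + 0) ^ 2 - 4 * D ^ 2)) :=
        (((tendsto_one_div_add_atTop_nhds_zero_nat.const_add D).pow 2).const_mul 4).sub
          ((hlim.pow 2).const_mul 4)
      have := (Real.continuous_sqrt.tendsto _).comp h1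
      simpa [Function.comp_def] using this
    rw [Metric.cauchySeq_iff']
    intro ε hε
    obtain ⟨N, hN⟩ := ((hb.eventually (gt_mem_nhds hε))).exists
    refine ⟨N, fun n hn => ?_⟩
    rw [dist_comm, dist_eq_norm]
    exact (Real.le_sqrt_of_sq_le (key N n hn)).trans_lt hN
  obtain ⟨z, hz⟩ := cauchySeq_tendsto_of_complete hcau
  exact ⟨y, z, hyC, hz⟩

theorem weak_limit {E H : Type*} [NormedAddCommGroup E] [NormedSpace ℝ E] [CompleteSpace E]
    [NormedAddCommGroup H] [InnerProductSpace ℝ H] [CompleteSpace H]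
    (μ : Measure ℝ) [IsFiniteMeasure μ] (f : ℕ → ℝ → H) (hf : ∀ k, AEStronglyMeasurable (f k) μ)
    (β : ℝ → ℝ) (hβ : Integrable β μ) (hfb : ∀ k, ∀ᵐ t ∂μ, ‖f k t‖ ≤ β t) :
    ∃ g : ℝ → H, Integrable g μ ∧
      (∀ᵐ t ∂μ, ∀ K : Set H, IsClosed K → Convex ℝ K → (∀ᶠ k in atTop, f k t ∈ K) → g t ∈ K) ∧
      ∀ (P : H →L[ℝ] E) (S : Set ℝ) (ξ : E),
        Tendsto (fun k => ∫ t in S, P (f k t) ∂μ) atTop (nhds ξ) → ∫ t in S, P (g t) ∂μ = ξ := by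
  -- normalised functions
  set γ : ℝ → ℝ := fun t => max (β t) 1 with hγ
  have hγi : Integrable γ μ := hβ.sup (integrable_const 1)
  have hγ1 : ∀ t, 1 ≤ γ t := fun t => le_max_right _ _
  have hγ0 : ∀ t, 0 < γ t := fun t => lt_of_lt_of_le one_pos (hγ1 t)
  have hfγ : ∀ k, ∀ᵐ t ∂μ, ‖f k t‖ ≤ γ t := fun k => (hfb k).mono fun t h => h.trans (le_max_left _ _)
  set h : ℕ → ℝ → H := fun k t => (γ t)⁻¹ • f k t with hh
  have hhm : ∀ k, AEStronglyMeasurable (h k) μ := fun k =>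
    (hγi.aestronglyMeasurable.aemeasurable.inv.aestronglyMeasurable).smul (hf k)
  have hhb : ∀ k, ∀ᵐ t ∂μ, ‖h k t‖ ≤ 1 := fun k => (hfγ k).mono fun t ht => by
    rw [hh]
    simp only [norm_smul, norm_inv, Real.norm_eq_abs, abs_of_pos (hγ0 t)]
    rw [inv_mul_le_iff₀ (hγ0 t)]
    linarith
  have hhL : ∀ k, MemLp (h k) 2 μ := fun k => MemLp.of_bound (hhm k) 1 (hhb k)
  set x : ℕ → Lp H 2 μ := fun k => (hhL k).toLp (h k) with hx
  have hxM : ∃ M, ∀ k, ‖x k‖ ≤ M := by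
    refine ⟨_, fun k => Lp.norm_le_of_ae_bound (C := 1) zero_le_one ?_⟩
    filter_upwards [(hhL k).coeFn_toLp, hhb k] with t h1 h2
    rw [h1]; exact h2
  obtain ⟨M, hM⟩ := hxM
  obtain ⟨y, z, hy, hyz⟩ := hilbert_mazur x M hM
  -- a.e. convergent subsequence
  have hmeas := tendstoInMeasure_of_tendsto_Lp hyz
  obtain ⟨φ, hφ, hae⟩ := hmeas.exists_seq_tendsto_ae
  have hxae : ∀ᵐ t ∂μ, ∀ k, x k t = h k t := ae_all_iff.2 fun k => (hhL k).coeFn_toLp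
  have hyae : ∀ᵐ t ∂μ, ∀ n, y n t ∈ convexHull ℝ ((fun k => h k t) '' Ici n) := by
    rw [ae_all_iff]
    intro n
    have hconv : Convex ℝ {q : Lp H 2 μ | ∀ᵐ t ∂μ, q t ∈ convexHull ℝ ((fun k => h k t) '' Ici n)} := by
      intro q hq r hr a b ha hb hab
      filter_upwards [hq, hr, Lp.coeFn_add (a • q) (b • r), Lp.coeFn_smul a q, Lp.coeFn_smul b r]
        with t h1 h2 h3 h4 h5
      rw [h3, Pi.add_apply, h4, h5]
      exact (convex_convexHull ℝ _) h1 h2 ha hb hab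
    refine convexHull_min ?_ hconv (hy n)
    rintro _ ⟨k, hk, rfl⟩
    filter_upwards [hxae] with t ht
    rw [ht k]
    exact subset_convexHull ℝ _ ⟨k, hk, rfl⟩
  have hcl : ∀ᵐ t ∂μ, ∀ K : Set H, IsClosed K → Convex ℝ K → (∀ᶠ k in atTop, f k t ∈ K) →
      γ t • z t ∈ K := by
    filter_upwards [hyae, hae] with t h1 h2 K hK1 hK2 hK3
    obtain ⟨N, hN⟩ := eventually_atTop.1 hK3
    have h3 : Tendsto (fun n => γ t • y (φ n) t) atTop (nhds (γ t • z t)) := h2.const_smul _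
    refine hK1.mem_of_tendsto h3 ?_
    filter_upwards [hφ.tendsto_atTop.eventually_ge_atTop N] with n hn
    have hc : Convex ℝ ((fun q : H => γ t • q) ⁻¹' K) :=
      hK2.is_linear_preimage (IsLinearMap.isLinearMap_smul (γ t))
    refine convexHull_min ?_ hc (h1 (φ n))
    rintro _ ⟨k, hk, rfl⟩
    simp only [mem_preimage, hh]
    rw [smul_inv_smul₀ (hγ0 t).ne']
    exact hN k (hn.trans hk)
  have hgm : AEStronglyMeasurable (fun t => γ t • z t) μ :=
    hγi.aestronglyMeasurable.smul (Lp.aestronglyMeasurable z)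
  have hyb : ∀ᵐ t ∂μ, ∀ n, ‖γ t • y n t‖ ≤ γ t := by
    filter_upwards [hyae, ae_all_iff.2 hhb] with t h1 h2 n
    have : y n t ∈ closedBall (0:H) 1 := by
      refine convexHull_min ?_ (convex_closedBall _ _) (h1 n)
      rintro _ ⟨k, hk, rfl⟩
      simpa using h2 k
    rw [norm_smul, Real.norm_eq_abs, abs_of_pos (hγ0 t)]
    have h3 : ‖y n t‖ ≤ 1 := by simpa using this
    have := hγ0 t
    nlinarith
  have hzb : ∀ᵐ t ∂μ, ‖γ t • z t‖ ≤ γ t := by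
    filter_upwards [hae, hyb] with t h1 h2
    exact le_of_tendsto' ((h1.const_smul (γ t)).norm) fun n => h2 _
  refine ⟨fun t => γ t • z t, hγi.mono' hgm hzb, hcl, ?_⟩
  intro P S ξ hξ
  -- integrals of the convex combinations converge to the integral of the limit
  have l1 : Tendsto (fun n => ∫ t in S, P (γ t • y (φ n) t) ∂μ) atTop
      (nhds (∫ t in S, P (γ t • z t) ∂μ)) := by
    refine tendsto_integral_of_dominated_convergence (fun t => ‖P‖ * γ t) ?_ ?_ ?_ ?_
    · intro n
      exact (P.continuous.comp_aestronglyMeasurable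
        (hγi.aestronglyMeasurable.smul (Lp.aestronglyMeasurable (y (φ n))))).restrict
    · exact (hγi.const_mul _).restrict
    · intro n
      filter_upwards [ae_restrict_of_ae hyb] with t ht
      exact (P.le_opNorm _).trans (by gcongr; exact ht _)
    · filter_upwards [ae_restrict_of_ae hae] with t ht
      exact (P.continuous.tendsto _).comp (ht.const_smul (γ t))
  refine tendsto_nhds_unique l1 ?_
  rw [Metric.tendsto_atTop] at hξ ⊢
  intro ε hε
  obtain ⟨N, hN⟩ := hξ (ε / 2) (half_pos hε)
  obtain ⟨N', hN'⟩ := eventually_atTop.1 (hφ.tendsto_atTop.eventually_ge_atTop N)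
  refine ⟨N', fun n hn => ?_⟩
  have hconv : Convex ℝ {q : Lp H 2 μ | Integrable (fun t => γ t • q t) μ ∧
      ∫ t in S, P (γ t • q t) ∂μ ∈ closedBall ξ (ε / 2)} := by
    intro q hq r hr a b ha hb hab
    obtain ⟨hq1, hq2⟩ := hq
    obtain ⟨hr1, hr2⟩ := hr
    have hee : (fun t => γ t • (a • q + b • r : Lp H 2 μ) t) =ᵐ[μ]
        fun t => a • (γ t • q t) + b • (γ t • r t) := by
      filter_upwards [Lp.coeFn_add (a • q) (b • r), Lp.coeFn_smul a q, Lp.coeFn_smul b r]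
        with t h3 h4 h5
      rw [h3, Pi.add_apply, h4, h5]
      simp only [Pi.smul_apply]
      rw [smul_add, smul_comm a, smul_comm b]
    refine ⟨((hq1.smul a).add (hr1.smul b)).congr hee.symm, ?_⟩
    have e2 : ∫ t in S, P (γ t • (a • q + b • r : Lp H 2 μ) t) ∂μ =
        a • ∫ t in S, P (γ t • q t) ∂μ + b • ∫ t in S, P (γ t • r t) ∂μ := by
      rw [← integral_smul, ← integral_smul, ← integral_add]
      · apply integral_congr_ae
        filter_upwards [ae_restrict_of_ae hee] with t ht
        rw [ht]
        simp
      · exact ((P.integrable_comp hq1).smul a).restrict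
      · exact ((P.integrable_comp hr1).smul b).restrict
    rw [e2]
    exact convex_closedBall _ _ hq2 hr2 ha hb hab
  have hmem : y (φ n) ∈ {q : Lp H 2 μ | Integrable (fun t => γ t • q t) μ ∧
      ∫ t in S, P (γ t • q t) ∂μ ∈ closedBall ξ (ε / 2)} := by
    refine convexHull_min ?_ hconv (hy (φ n))
    rintro _ ⟨k, hk, rfl⟩
    have hee : (fun t => γ t • x k t) =ᵐ[μ] f k := by
      filter_upwards [hxae] with t ht
      rw [ht k]
      simp only [hh]
      rw [smul_inv_smul₀ (hγ0 t).ne']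
    refine ⟨(hγi.mono' (hf k) (hfγ k)).congr hee.symm, ?_⟩
    have e : ∫ t in S, P (γ t • x k t) ∂μ = ∫ t in S, P (f k t) ∂μ := by
      apply integral_congr_ae
      filter_upwards [ae_restrict_of_ae hee] with t ht
      rw [ht]
    rw [e]
    exact (hN k ((hN' n hn).trans hk)).le
  have := hmem.2
  rw [mem_closedBall] at this
  linarith


theorem delay_exists {E : Type*} [NormedAddCommGroup E] [NormedSpace ℝ E] [CompleteSpace E]
    (T h : ℝ) (hh : 0 < h) (g : ℝ → E → E) (b : ℝ → ℝ) (hb : Integrable b)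
    (hg0 : ∀ s ≤ 0, ∀ e, g s e = 0)
    (hgb : ∀ᵐ s, ∀ e, ‖g s e‖ ≤ b s)
    (hgm : ∀ x : ℝ → E, Continuous x → AEStronglyMeasurable (fun s => g s (x s)) volume)
    (u0 : E) :
    ∃ u : ℝ → E, Continuous u ∧ Integrable (fun s => g s (u (s - h))) ∧
      ∀ t ≤ T, u t = u0 + ∫ s in (0:ℝ)..t, g s (u (s - h)) := by
  have hgInt : ∀ x : ℝ → E, Continuous x → Integrable (fun s => g s (x (s - h))) := by
    intro x hx
    exact hb.mono' (hgm (fun s => x (s - h)) (hx.comp (continuous_sub_right h)))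
      (hgb.mono fun s hs => hs _)
  let Φ : (ℝ → E) → (ℝ → E) := fun x t => u0 + ∫ s in (0:ℝ)..t, g s (x (s - h))
  let U : ℕ → ℝ → E := fun j => Φ^[j] (fun _ => u0)
  have hUs : ∀ j, U (j + 1) = Φ (U j) := fun j => Function.iterate_succ_apply' _ _ _
  have hUc : ∀ j, Continuous (U j) := by
    intro j
    induction j with
    | zero => exact continuous_const
    | succ j ih =>
      rw [hUs]
      exact continuous_const.add
        (intervalIntegral.continuous_primitive (fun a b => (hgInt _ ih).intervalIntegrable) 0)
  have hstep : ∀ j : ℕ, ∀ t ≤ j * h, U (j + 1) t = U j t := by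
    intro j
    induction j with
    | zero =>
      intro t ht
      simp only [Nat.cast_zero, zero_mul] at ht
      rw [hUs]
      change u0 + ∫ s in (0:ℝ)..t, g s (U 0 (s - h)) = u0
      rw [intervalIntegral.integral_congr (g := fun _ => (0 : E))]
      · simp
      · intro s hs
        rw [uIcc_of_ge ht] at hs
        exact hg0 s hs.2 _
    | succ j ih =>
      intro t ht
      have e1 : U (j + 1 + 1) t = Φ (U (j + 1)) t := by rw [hUs (j + 1)]
      have e2 : U (j + 1) t = Φ (U j) t := by rw [hUs j]
      rw [e1, e2]
      change u0 + ∫ s in (0:ℝ)..t, g s (U (j + 1) (s - h)) = u0 + ∫ s in (0:ℝ)..t, g s (U j (s - h))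
      congr 1
      apply intervalIntegral.integral_congr
      intro s hs
      have hj : (0:ℝ) ≤ ((j + 1 : ℕ) : ℝ) * h := by positivity
      have hs2 : s ≤ ((j + 1 : ℕ) : ℝ) * h := by
        have := hs.2
        exact this.trans (max_le hj ht)
      change g s (U (j + 1) (s - h)) = g s (U j (s - h))
      rw [ih]
      push_cast at hs2
      linarith
  obtain ⟨N, hN⟩ := exists_nat_ge (T / h)
  have hN' : T ≤ N * h := by rwa [div_le_iff₀ hh] at hN
  refine ⟨U N, hUc N, hgInt _ (hUc N), fun t ht => ?_⟩
  rw [← hstep N t (ht.trans hN'), hUs]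

theorem ac_of_dist_le_s10 {f : ℝ → ℝ} {B : ℝ → ℝ} {a b K : ℝ} (hB : AbsolutelyContinuousOnInterval B a b)
    (h : ∀ x ∈ uIcc a b, ∀ y ∈ uIcc a b, dist (f x) (f y) ≤ K * dist (B x) (B y)) :
    AbsolutelyContinuousOnInterval f a b := by
  rw [absolutelyContinuousOnInterval_iff] at hB ⊢
  intro ε hε
  have hK : 0 < |K| + 1 := by positivity
  obtain ⟨δ, hδ, hd⟩ := hB (ε / (|K| + 1)) (by positivity)
  refine ⟨δ, hδ, fun E hE hl => ?_⟩
  have h1 := hd E hE hl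
  rw [lt_div_iff₀ hK] at h1
  refine lt_of_le_of_lt ?_ h1
  rw [Finset.sum_mul]
  apply Finset.sum_le_sum
  intro i hi
  have hm := hE.1 i hi
  refine (h _ hm.1 _ hm.2).trans ?_
  rw [mul_comm]
  gcongr
  linarith [le_abs_self K]

theorem primitive_dist {H : Type*} [NormedAddCommGroup H] [NormedSpace ℝ H]
    {x x' : ℝ → H} (hx' : Integrable x') (hx : ∀ t, x t = x 0 + ∫ s in (0:ℝ)..t, x' s) (s t : ℝ) :
    dist (x s) (x t) ≤ dist (∫ τ in (0:ℝ)..s, ‖x' τ‖) (∫ τ in (0:ℝ)..t, ‖x' τ‖) := by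
  have e1 : x s - x t = ∫ τ in t..s, x' τ := by
    rw [hx s, hx t, add_sub_add_left_eq_sub,
      intervalIntegral.integral_interval_sub_left hx'.intervalIntegrable hx'.intervalIntegrable]
  have e2 : (∫ τ in (0:ℝ)..s, ‖x' τ‖) - (∫ τ in (0:ℝ)..t, ‖x' τ‖) = ∫ τ in t..s, ‖x' τ‖ :=
    intervalIntegral.integral_interval_sub_left hx'.norm.intervalIntegrable
      hx'.norm.intervalIntegrable
  rw [dist_eq_norm, dist_eq_norm, e1, e2]
  exact intervalIntegral.norm_integral_le_abs_integral_norm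

theorem primitive_ae_deriv {H : Type*} [NormedAddCommGroup H] [NormedSpace ℝ H] [CompleteSpace H]
    {x x' : ℝ → H} (hx' : Integrable x') (hx : ∀ t, x t = x 0 + ∫ s in (0:ℝ)..t, x' s) :
    ∀ᵐ t, HasDerivAt x (x' t) t := by
  filter_upwards [LocallyIntegrable.ae_hasDerivAt_integral hx'.locallyIntegrable] with t ht
  have := (ht 0).const_add (x 0)
  have e : x = fun t => x 0 + ∫ s in (0:ℝ)..t, x' s := funext hx
  rw [e]
  simpa using this

theorem sqrt_lip (ε a b : ℝ) : |√(a ^ 2 + ε ^ 2) - √(b ^ 2 + ε ^ 2)| ≤ |a - b| := by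
  have h1 : √(a ^ 2 + ε ^ 2) ^ 2 = a ^ 2 + ε ^ 2 := Real.sq_sqrt (by positivity)
  have h2 : √(b ^ 2 + ε ^ 2) ^ 2 = b ^ 2 + ε ^ 2 := Real.sq_sqrt (by positivity)
  have p1 := Real.sqrt_nonneg (a ^ 2 + ε ^ 2)
  have p2 := Real.sqrt_nonneg (b ^ 2 + ε ^ 2)
  set A := √(a ^ 2 + ε ^ 2)
  set B := √(b ^ 2 + ε ^ 2)
  apply abs_le_of_sq_le_sq' _ (abs_nonneg _) |> abs_le.2
  rw [sq_abs]
  have : a * b + ε ^ 2 ≤ A * B := by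
    apply le_of_sq_le_sq _ (by positivity)
    rw [mul_pow, h1, h2]
    nlinarith [sq_nonneg (ε * (a - b))]
  nlinarith

theorem energy_identity {H : Type*} [NormedAddCommGroup H] [InnerProductSpace ℝ H] [CompleteSpace H]
    {x x' : ℝ → H} (hx' : Integrable x') (hx : ∀ t, x t = x 0 + ∫ s in (0:ℝ)..t, x' s)
    (q : ℝ → ℝ) (hq : Integrable q) (T : ℝ) (hT : 0 ≤ T)
    (hle : ∀ᵐ t ∂volume.restrict (Ioo (0:ℝ) T), 2 * ⟪x' t, x t⟫ ≤ q t) :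
    ‖x T‖ ^ 2 - ‖x 0‖ ^ 2 ≤ ∫ t in Ioo (0:ℝ) T, q t := by
  have hBac : AbsolutelyContinuousOnInterval (fun t => ∫ τ in (0:ℝ)..t, ‖x' τ‖) 0 T :=
    hx'.norm.intervalIntegrable.absolutelyContinuousOnInterval_intervalIntegral left_mem_uIcc
  have hnac : AbsolutelyContinuousOnInterval (fun t => ‖x t‖) 0 T := by
    refine ac_of_dist_le_s10 (K := 1) hBac fun s _ t _ => ?_
    rw [one_mul]
    refine le_trans ?_ (primitive_dist hx' hx s t)
    rw [dist_eq_norm (x s)]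
    exact dist_norm_norm_le _ _
  have hac := hnac.mul hnac
  have hI := hac.integral_deriv_eq_sub
  have hd : ∀ᵐ t, HasDerivAt (fun t => ‖x t‖ * ‖x t‖) (2 * ⟪x' t, x t⟫) t := by
    filter_upwards [primitive_ae_deriv hx' hx] with t ht
    have := ht.norm_sq
    rw [real_inner_comm]
    simpa [sq] using this
  have h1 : ‖x T‖ ^ 2 - ‖x 0‖ ^ 2 = ∫ t in (0:ℝ)..T, deriv (fun t => ‖x t‖ * ‖x t‖) t := by
    have := hI
    simp only [sq]
    exact this.symm
  rw [h1, intervalIntegral.integral_of_le hT, integral_Ioc_eq_integral_Ioo]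
  refine integral_mono_ae ?_ hq.restrict ?_
  · have := hac.intervalIntegrable_deriv
    rw [intervalIntegrable_iff_integrableOn_Ioo_of_le hT] at this
    exact this
  · filter_upwards [hle, ae_restrict_of_ae hd] with t h2 h3
    have := h3.deriv
    change deriv (fun t => ‖x t‖ * ‖x t‖) t ≤ _
    rw [this]; exact h2

theorem gronwall_ac {H : Type*} [NormedAddCommGroup H] [InnerProductSpace ℝ H] [CompleteSpace H]
    {x x' : ℝ → H} (hx' : Integrable x') (hx : ∀ t, x t = x 0 + ∫ s in (0:ℝ)..t, x' s)
    (m d : ℝ → ℝ) (hm : Integrable m) (hd : Integrable d) (hd0 : ∀ t, 0 ≤ d t) (T C : ℝ)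
    (hle : ∀ᵐ t ∂volume.restrict (Ioo (0:ℝ) T), ⟪x' t, x t⟫ ≤ d t * ‖x t‖ + m t * ‖x t‖ ^ 2)
    (hC : ∀ s t, 0 ≤ s → s ≤ t → t ≤ T → Real.exp (∫ τ in s..t, m τ) ≤ C)
    (t : ℝ) (ht : t ∈ Icc (0:ℝ) T) :
    ‖x t‖ ≤ C * (‖x 0‖ + ∫ s in Ioo (0:ℝ) T, d s) := by
  have hC0 : 0 < C := (Real.exp_pos _).trans_le (hC t t ht.1 le_rfl ht.2)
  set M : ℝ → ℝ := fun t => ∫ τ in (0:ℝ)..t, m τ with hM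
  have hMac : AbsolutelyContinuousOnInterval M 0 t :=
    hm.intervalIntegrable.absolutelyContinuousOnInterval_intervalIntegral left_mem_uIcc
  have hBac : AbsolutelyContinuousOnInterval (fun t => ∫ τ in (0:ℝ)..t, ‖x' τ‖) 0 t :=
    hx'.norm.intervalIntegrable.absolutelyContinuousOnInterval_intervalIntegral left_mem_uIcc
  have hMdiff : ∀ s r, M r - M s = ∫ τ in s..r, m τ := fun s r =>
    intervalIntegral.integral_interval_sub_left hm.intervalIntegrable hm.intervalIntegrable
  have hMb : ∀ s, |M s| ≤ ∫ τ, |m τ| := by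
    intro s
    refine (intervalIntegral.norm_integral_le_integral_norm_uIoc (f := m)).trans ?_
    exact setIntegral_le_integral hm.norm (ae_of_all _ fun _ => norm_nonneg _)
  set Mb := ∫ τ, |m τ|
  have hexpac : AbsolutelyContinuousOnInterval (fun s => Real.exp (- M s)) 0 t := by
    refine ac_of_dist_le_s10 (K := Real.exp Mb) hMac fun s _ r _ => ?_
    rw [Real.dist_eq, Real.dist_eq]
    have key : ∀ p q : ℝ, |p| ≤ Mb → |q| ≤ Mb → Real.exp (-p) - Real.exp (-q) ≤ Real.exp Mb * |p - q| := by
      intro p q hp hq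
      have h1 : Real.exp (-p) - Real.exp (-q) = Real.exp (-p) * (1 - Real.exp (p - q)) := by
        rw [mul_sub, ← Real.exp_add]; ring_nf
      have h2 : 1 - Real.exp (p - q) ≤ |p - q| := by
        have := Real.add_one_le_exp (p - q)
        have := neg_abs_le (p - q)
        linarith
      rw [h1]
      have h3 : Real.exp (-p) ≤ Real.exp Mb := Real.exp_le_exp.2 (by linarith [neg_abs_le p])
      have h4 := Real.exp_pos (-p)
      calc Real.exp (-p) * (1 - Real.exp (p - q)) ≤ Real.exp (-p) * |p - q| := by gcongr
        _ ≤ _ := by gcongr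
    rw [abs_le]
    have k1 := key _ _ (hMb s) (hMb r)
    have k2 := key _ _ (hMb r) (hMb s)
    rw [abs_sub_comm] at k2
    constructor <;> linarith
  have main : ∀ ε > 0, ‖x t‖ ≤ C * ((‖x 0‖ + ε) + ((∫ s in Ioo (0:ℝ) T, d s) + ε * Mb)) := by
    intro ε hε
    set N : ℝ → ℝ := fun s => √(‖x s‖ ^ 2 + ε ^ 2) with hN
    have hNac : AbsolutelyContinuousOnInterval N 0 t := by
      refine ac_of_dist_le_s10 (K := 1) hBac fun s _ r _ => ?_
      rw [one_mul]
      refine le_trans ?_ (primitive_dist hx' hx s r)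
      refine le_trans (sqrt_lip ε ‖x s‖ ‖x r‖) ?_
      rw [← Real.dist_eq, dist_eq_norm (x s)]
      exact dist_norm_norm_le _ _
    have hNsq : ∀ s, N s ^ 2 = ‖x s‖ ^ 2 + ε ^ 2 := fun s => Real.sq_sqrt (by positivity)
    have hNε : ∀ s, ε ≤ N s := fun s => Real.le_sqrt_of_sq_le (by nlinarith [sq_nonneg ‖x s‖])
    have hNx : ∀ s, ‖x s‖ ≤ N s := fun s => Real.le_sqrt_of_sq_le (by nlinarith)
    have hac := hexpac.mul hNac
    have hI := hac.integral_deriv_eq_sub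
    have hMd : ∀ᵐ s, HasDerivAt M (m s) s := by
      refine primitive_ae_deriv hm fun t => ?_
      simp [hM]
    have hder : ∀ᵐ s, HasDerivAt ((fun s => Real.exp (- M s)) * N)
        (Real.exp (- M s) * (⟪x' s, x s⟫ / N s - m s * N s)) s := by
      filter_upwards [primitive_ae_deriv hx' hx, hMd] with s h1 h2
      have h3 := h2.fun_neg.exp
      have h4 := (h1.norm_sq.add_const (ε ^ 2)).sqrt (by positivity)
      have h5 := h3.mul h4
      refine h5.congr_deriv ?_
      have hpos := hε.trans_le (hNε s)
      change Real.exp (-M s) * -m s * N s + Real.exp (-M s) * (2 * ⟪x s, x' s⟫ / (2 * N s)) = _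
      rw [real_inner_comm]
      field_simp
      ring
    have hb : ∀ᵐ s ∂volume.restrict (Ioo 0 t),
        deriv ((fun s => Real.exp (- M s)) * N) s * Real.exp (M t) ≤ C * (d s + |m s| * ε) := by
      have hsub : Ioo 0 t ⊆ Ioo 0 T := Ioo_subset_Ioo_right ht.2
      filter_upwards [ae_restrict_of_ae hder, ae_restrict_of_ae_restrict_of_subset hsub hle,
        ae_restrict_mem measurableSet_Ioo] with s h1 h2 hs
      rw [h1.deriv]
      have hpos := hε.trans_le (hNε s)
      have k1 : ⟪x' s, x s⟫ / N s - m s * N s ≤ d s + |m s| * ε := by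
        rw [sub_le_iff_le_add, div_le_iff₀ hpos]
        refine h2.trans ?_
        have k2 : d s * ‖x s‖ ≤ d s * N s := by gcongr; exacts [hd0 s, hNx s]
        have k3 : - m s * ε ^ 2 ≤ |m s| * ε * N s := by
          calc - m s * ε ^ 2 ≤ |m s| * ε ^ 2 := by gcongr; exact neg_le_abs _
            _ = |m s| * ε * ε := by ring
            _ ≤ _ := by gcongr; exact hNε s
        have k4 := hNsq s
        have : ‖x s‖ ^ 2 = N s ^ 2 - ε ^ 2 := by linarith
        rw [this]
        nlinarith
      have k5 : Real.exp (-M s) * Real.exp (M t) ≤ C := by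
        rw [← Real.exp_add]
        have := hC s t hs.1.le hs.2.le ht.2
        rw [← hMdiff] at this
        convert this using 2
        ring
      have k6 : 0 ≤ d s + |m s| * ε := by have := hd0 s; positivity
      calc Real.exp (-M s) * (⟪x' s, x s⟫ / N s - m s * N s) * Real.exp (M t)
          = (Real.exp (-M s) * Real.exp (M t)) * (⟪x' s, x s⟫ / N s - m s * N s) := by ring
        _ ≤ (Real.exp (-M s) * Real.exp (M t)) * (d s + |m s| * ε) := by gcongr
        _ ≤ _ := by gcongr
    have hIb : (∫ s in (0:ℝ)..t, deriv ((fun s => Real.exp (- M s)) * N) s) * Real.exp (M t) ≤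
        C * ((∫ s in Ioo (0:ℝ) T, d s) + ε * Mb) := by
      rw [intervalIntegral.integral_of_le ht.1, integral_Ioc_eq_integral_Ioo, ← integral_mul_const]
      have hi1 : Integrable (fun s => C * (d s + |m s| * ε)) :=
        ((hd.add (hm.abs.mul_const ε)).const_mul C)
      have hIoo : IntegrableOn (deriv ((fun s => Real.exp (- M s)) * N)) (Ioo 0 t) := by
        have := hac.intervalIntegrable_deriv
        rwa [intervalIntegrable_iff_integrableOn_Ioo_of_le ht.1] at this
      refine (integral_mono_ae (hIoo.mul_const _) hi1.restrict hb).trans ?_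
      rw [integral_const_mul]
      gcongr
      rw [integral_add hd.restrict (hm.abs.mul_const ε).restrict, integral_mul_const, mul_comm]
      refine add_le_add ?_ (mul_le_mul_of_nonneg_left ?_ hε.le)
      · exact setIntegral_mono_set hd.restrict (ae_of_all _ hd0)
          (Ioo_subset_Ioo_right ht.2).eventuallyLE
      · exact setIntegral_le_integral hm.abs (ae_of_all _ fun _ => abs_nonneg _)
    rw [hI] at hIb
    simp only [Pi.mul_apply] at hIb
    have hM0 : M 0 = 0 := by simp [hM]
    have e1 : Real.exp (-M t) * N t * Real.exp (M t) = N t := by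
      rw [mul_right_comm, ← Real.exp_add]; simp
    rw [sub_mul, e1, hM0] at hIb
    have e2 : N 0 ≤ ‖x 0‖ + ε := by
      apply Real.sqrt_le_iff.2
      constructor
      · positivity
      · nlinarith [norm_nonneg (x 0)]
    have e3 : Real.exp (M t) ≤ C := by
      have := hC 0 t le_rfl ht.1 ht.2
      exact this
    have e4 : Real.exp (-0) * N 0 * Real.exp (M t) ≤ C * (‖x 0‖ + ε) := by
      simp only [neg_zero, Real.exp_zero, one_mul]
      rw [mul_comm]
      have : 0 ≤ N 0 := hε.le.trans (hNε 0)
      gcongr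
    have := hNx t
    linarith
  have hlim : Tendsto (fun ε : ℝ => C * ((‖x 0‖ + ε) + ((∫ s in Ioo (0:ℝ) T, d s) + ε * Mb)))
      (nhdsWithin 0 (Ioi 0)) (nhds (C * ((‖x 0‖ + 0) + ((∫ s in Ioo (0:ℝ) T, d s) + 0 * Mb)))) := by
    apply Tendsto.mono_left _ nhdsWithin_le_nhds
    exact Continuous.tendsto (by fun_prop) 0
  have := ge_of_tendsto hlim (eventually_nhdsWithin_of_forall fun ε hε => main ε hε)
  simpa using this


theorem intInd {E : Type*} [NormedAddCommGroup E] [NormedSpace ℝ E] (T t : ℝ) (ht : 0 ≤ t)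
    (G : ℝ → E) : ∫ s in (0:ℝ)..t, (Ioo (0:ℝ) T).indicator G s =
      ∫ s in Ioc 0 t, G s ∂(volume.restrict (Ioo (0:ℝ) T)) := by
  rw [intervalIntegral.integral_of_le ht, setIntegral_indicator measurableSet_Ioo,
    Measure.restrict_restrict measurableSet_Ioc]

theorem trunc_exists {E H : Type*} [NormedAddCommGroup E] [NormedSpace ℝ E] [FiniteDimensional ℝ E]
    [NormedAddCommGroup H] [InnerProductSpace ℝ H] [CompleteSpace H]
    [TopologicalSpace.SeparableSpace H] (T : ℝ) (hT : 0 < T) (F : ℝ → E → Set H)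
    (hF : ∀ t ∈ Icc (0:ℝ) T, ∀ v : E, (F t v).Nonempty ∧ IsClosed (F t v) ∧
      Bornology.IsBounded (F t v) ∧ Convex ℝ (F t v))
    (hFmeas : ∀ v : E, ∀ M : Set H, IsOpen M →
      MeasurableSet {t | t ∈ Icc (0:ℝ) T ∧ (F t v ∩ M).Nonempty})
    (hFcont : ∀ᵐ t ∂volume.restrict (Ioo (0:ℝ) T), ∀ v : E, ∀ vk : ℕ → E,
      Tendsto vk atTop (nhds v) →
      Tendsto (fun k => hausdorffDist (F t v) (F t (vk k))) atTop (nhds 0))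
    (J : E →L[ℝ] H) (P : H →L[ℝ] E) (A : E →L[ℝ] E)
    (ℓ : ℝ → ℝ)
    (hA4 : ∀ᵐ t ∂volume.restrict (Ioo (0:ℝ) T), ∀ v v2 : E, ∀ g ∈ F t v,
      ∃ g' ∈ F t v2, ⟪g - g', J v - J v2⟫ ≤ ℓ t * ‖J v - J v2‖ ^ 2)
    (ρ : ℝ → E → E) (hρ : Continuous (fun q : ℝ × E => ρ q.1 q.2)) (R : ℝ)
    (hρR : ∀ t ∈ Ioo (0:ℝ) T, ∀ e, ‖ρ t e‖ ≤ R)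
    (β : ℝ → ℝ) (hβ : IntegrableOn β (Ioo 0 T))
    (hFβ : ∀ᵐ t ∂volume.restrict (Ioo (0:ℝ) T), ∀ e, ‖e‖ ≤ R → ∀ f ∈ F t e, ‖f‖ ≤ β t)
    (v : ℝ → E) (hv : Continuous v) (p : ℝ → H)
    (hpm : AEStronglyMeasurable p (volume.restrict (Ioo (0:ℝ) T)))
    (hp : ∀ᵐ t ∂volume.restrict (Ioo (0:ℝ) T), p t ∈ F t (v t) ∧ ‖p t‖ ≤ β t)
    (u0 : E) :
    ∃ (u : ℝ → E) (f : ℝ → H), Continuous u ∧ IntegrableOn f (Ioo 0 T) ∧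
      (∀ t, u t = u0 + ∫ s in (0:ℝ)..t, (Ioo (0:ℝ) T).indicator (fun s => P (f s) - A (ρ s (u s))) s) ∧
      Integrable ((Ioo (0:ℝ) T).indicator (fun s => P (f s) - A (ρ s (u s)))) ∧
      (∀ᵐ t ∂volume.restrict (Ioo (0:ℝ) T), f t ∈ F t (ρ t (u t)) ∧
        ⟪p t - f t, J (v t) - J (ρ t (u t))⟫ ≤ ℓ t * ‖J (v t) - J (ρ t (u t))‖ ^ 2) := by
  have : CompleteSpace E := FiniteDimensional.complete ℝ E
  have : ProperSpace E := FiniteDimensional.proper ℝ E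
  set μ := volume.restrict (Ioo (0:ℝ) T) with hμ
  have hR0 : 0 ≤ R := (norm_nonneg _).trans (hρR (T / 2) ⟨by linarith, by linarith⟩ 0)
  -- the approximate selections
  let sel : ℕ → ℝ → E → H := fun n t e =>
    nproj (F t (ρ t e)) (p t + ((n : ℝ) + 1) • (J (v t) - J (ρ t e)))
  let g : ℕ → ℝ → E → E := fun n t e =>
    (Ioo (0:ℝ) T).indicator (fun t => P (sel n t e) - A (ρ t e)) t
  set b : ℝ → ℝ := (Ioo (0:ℝ) T).indicator (fun t => ‖P‖ * β t + ‖A‖ * R) with hbdef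
  have hb : Integrable b := by
    rw [hbdef, integrable_indicator_iff measurableSet_Ioo]
    exact (hβ.const_mul _).add (integrable_const _)
  have hselF : ∀ t ∈ Ioo (0:ℝ) T, ∀ n e, sel n t e ∈ F t (ρ t e) := fun t ht n e => by
    obtain ⟨a1, a2, a3, a4⟩ := hF t (Ioo_subset_Icc_self ht) (ρ t e)
    exact (nproj_spec a1 a2 a4 _).1
  have hselb : ∀ᵐ t ∂μ, ∀ n e, ‖sel n t e‖ ≤ β t := by
    filter_upwards [hFβ, ae_restrict_mem measurableSet_Ioo] with t h1 ht n e
    exact h1 _ (hρR t ht e) _ (hselF t ht n e)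
  have hgb : ∀ n, ∀ᵐ s, ∀ e, ‖g n s e‖ ≤ b s := by
    intro n
    have := (ae_restrict_iff' measurableSet_Ioo).1 hselb
    filter_upwards [this] with s hs e
    by_cases h : s ∈ Ioo (0:ℝ) T
    · simp only [g, b, indicator_of_mem h]
      refine (norm_sub_le _ _).trans ?_
      refine add_le_add ((P.le_opNorm _).trans ?_) ((A.le_opNorm _).trans ?_)
      · gcongr; exact hs h n e
      · gcongr; exact hρR s h e
    · simp only [g, b, indicator_of_notMem h, norm_zero, le_refl]
  have hρc : ∀ x : ℝ → E, Continuous x → Continuous fun s => ρ s (x s) := fun x hx =>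
    hρ.comp (continuous_id.prodMk hx)
  have hselm : ∀ n, ∀ x : ℝ → E, Continuous x → AEStronglyMeasurable (fun s => sel n s (x s)) μ := by
    intro n x hx
    refine sel_meas T F hF hFmeas hFcont (fun s => ρ s (x s)) _
      (hρc x hx).aestronglyMeasurable (hpm.add ?_)
    refine Continuous.aestronglyMeasurable ?_
    have := hρc x hx
    fun_prop
  have hgm : ∀ n, ∀ x : ℝ → E, Continuous x → AEStronglyMeasurable (fun s => g n s (x s)) volume := by
    intro n x hx
    have e : (fun s => g n s (x s)) =
        (Ioo (0:ℝ) T).indicator (fun t => P (sel n t (x t)) - A (ρ t (x t))) := by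
      ext s
      by_cases h : s ∈ Ioo (0:ℝ) T
      · simp only [g, indicator_of_mem h]
      · simp only [g, indicator_of_notMem h]
    rw [e, aestronglyMeasurable_indicator_iff measurableSet_Ioo]
    exact (P.continuous.comp_aestronglyMeasurable (hselm n x hx)).sub
      (A.continuous.comp (hρc x hx)).aestronglyMeasurable
  have hdel := fun n : ℕ => delay_exists T (1 / ((n : ℝ) + 1)) (by positivity) (g n) b hb
    (fun s hs e => indicator_of_notMem (fun h => absurd h.1 (not_lt.2 hs)) _) (hgb n) (hgm n) u0
  choose U hUc hUi hU using hdel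
  set B : ℝ → ℝ := fun t => ∫ s in (0:ℝ)..t, b s with hB
  have hBc : Continuous B :=
    intervalIntegral.continuous_primitive (fun a c => hb.intervalIntegrable) 0
  have hUB : ∀ n, ∀ s ≤ T, ∀ t ≤ T, dist (U n s) (U n t) ≤ dist (B s) (B t) := by
    intro n s hs t ht
    have e1 : U n s - U n t = ∫ τ in t..s, g n τ (U n (τ - 1 / ((n : ℝ) + 1))) := by
      rw [hU n s hs, hU n t ht, add_sub_add_left_eq_sub,
        intervalIntegral.integral_interval_sub_left (hUi n).intervalIntegrable
          (hUi n).intervalIntegrable]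
    have e2 : B s - B t = ∫ τ in t..s, b τ :=
      intervalIntegral.integral_interval_sub_left hb.intervalIntegrable hb.intervalIntegrable
    rw [dist_eq_norm, dist_eq_norm, e1, e2]
    refine intervalIntegral.norm_integral_le_abs_of_norm_le ?_ hb.intervalIntegrable
    exact ae_restrict_of_ae ((hgb n).mono fun τ h => h _)
  have hU0 : ∀ n, U n 0 = u0 := fun n => by rw [hU n 0 hT.le]; simp
  -- Arzela-Ascoli
  obtain ⟨φ, hφ, Ũ, hŨ⟩ : ∃ φ : ℕ → ℕ, StrictMono φ ∧ ∃ Ũ : C(Icc (0:ℝ) T, E),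
      ∀ t : Icc (0:ℝ) T, Tendsto (fun k => U (φ k) t) atTop (nhds (Ũ t)) := by
    let W : ℕ → BoundedContinuousFunction (Icc (0:ℝ) T) E := fun n =>
      BoundedContinuousFunction.mkOfCompact ⟨fun t => U n t, (hUc n).comp continuous_subtype_val⟩
    obtain ⟨D, hD⟩ := (isCompact_Icc (a := (0:ℝ)) (b := T)).exists_bound_of_continuousOn hBc.continuousOn
    have hcomp : IsCompact (closure (range W)) := by
      refine BoundedContinuousFunction.arzela_ascoli (closedBall u0 D) (isCompact_closedBall _ _) _ ?_ ?_
      · rintro _ t ⟨n, rfl⟩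
        change U n t ∈ _
        rw [mem_closedBall, ← hU0 n]
        refine (hUB n t t.2.2 0 hT.le).trans ?_
        have : B 0 = 0 := by simp [hB]
        rw [this, dist_zero_right]
        exact hD t t.2
      · intro t
        rw [Metric.equicontinuousAt_iff]
        intro ε hε
        obtain ⟨δ, hδ, h⟩ := Metric.continuous_iff.1 hBc t ε hε
        refine ⟨δ, hδ, fun s hs i => ?_⟩
        obtain ⟨_, n, rfl⟩ := i
        change dist (U n t) (U n s) < ε
        refine (hUB n t t.2.2 s s.2.2).trans_lt ?_
        rw [dist_comm]
        exact h s hs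
    obtain ⟨L, -, φ, hφ, hL⟩ := hcomp.tendsto_subseq (x := W) fun n => subset_closure ⟨n, rfl⟩
    refine ⟨φ, hφ, L.toContinuousMap, fun t => ?_⟩
    exact ((BoundedContinuousFunction.lipschitz_eval_const t).continuous.tendsto L).comp hL
  set ũ : ℝ → E := IccExtend hT.le Ũ with hũ
  have hũc : Continuous ũ := Ũ.continuous.Icc_extend'
  have hũlim : ∀ t ∈ Icc (0:ℝ) T, Tendsto (fun k => U (φ k) t) atTop (nhds (ũ t)) := by
    intro t ht
    rw [hũ, IccExtend_of_mem hT.le Ũ ht]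
    exact hŨ ⟨t, ht⟩
  set hk : ℕ → ℝ := fun k => 1 / ((φ k : ℝ) + 1) with hhk
  have hklim : Tendsto hk atTop (nhds 0) :=
    tendsto_one_div_add_atTop_nhds_zero_nat.comp hφ.tendsto_atTop
  have hk0 : ∀ k, 0 < hk k := fun k => by simp only [hhk]; positivity
  have hdlim : ∀ t ∈ Icc (0:ℝ) T, Tendsto (fun k => U (φ k) (t - hk k)) atTop (nhds (ũ t)) := by
    intro t ht
    have h1 : Tendsto (fun k => dist (B (t - hk k)) (B t)) atTop (nhds 0) := by
      rw [← tendsto_iff_dist_tendsto_zero]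
      have := (hBc.tendsto (t - 0)).comp (hklim.const_sub t)
      simpa [Function.comp_def] using this
    have h2 := (tendsto_iff_dist_tendsto_zero.1 (hũlim t ht)).add h1
    rw [tendsto_iff_dist_tendsto_zero]
    rw [add_zero] at h2
    refine squeeze_zero (fun _ => dist_nonneg) (fun k => ?_) h2
    have := hUB (φ k) (t - hk k) (by linarith [hk0 k, ht.2]) t ht.2
    have h3 := dist_triangle (U (φ k) (t - hk k)) (U (φ k) t) (ũ t)
    linarith
  -- approximations
  let w : ℕ → ℝ → E := fun k t => ρ t (U (φ k) (t - hk k))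
  let f : ℕ → ℝ → H := fun k t => sel (φ k) t (U (φ k) (t - hk k))
  have hwlim : ∀ t ∈ Icc (0:ℝ) T, Tendsto (fun k => w k t) atTop (nhds (ρ t (ũ t))) := by
    intro t ht
    exact (hρ.tendsto (t, ũ t)).comp (tendsto_const_nhds.prodMk_nhds (hdlim t ht))
  have hsc : ∀ k, Continuous fun t => U (φ k) (t - hk k) := fun k =>
    (hUc (φ k)).comp (continuous_sub_right _)
  have hwc : ∀ k, Continuous (w k) := fun k => hρc _ (hsc k)
  have hfm : ∀ k, AEStronglyMeasurable (f k) μ := fun k => hselm _ _ (hsc k)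
  have hfb : ∀ k, ∀ᵐ t ∂μ, ‖f k t‖ ≤ β t := fun k => hselb.mono fun t h => h _ _
  obtain ⟨fl, hfli, hflK, hflP⟩ := weak_limit (E := E) μ f hfm β hβ hfb
  have hAi : Integrable (fun s => A (ρ s (ũ s))) μ := by
    refine Integrable.mono' (integrable_const (‖A‖ * R))
      (A.continuous.comp (hρc ũ hũc)).aestronglyMeasurable ?_
    filter_upwards [ae_restrict_mem measurableSet_Ioo] with s hs
    refine (A.le_opNorm _).trans ?_
    gcongr
    exact hρR s hs _
  have hPi : Integrable (fun s => P (fl s)) μ := P.integrable_comp hfli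
  have heq : ∀ t ∈ Icc (0:ℝ) T, ũ t = u0 + ∫ s in (0:ℝ)..t,
      (Ioo (0:ℝ) T).indicator (fun s => P (fl s) - A (ρ s (ũ s))) s := by
    intro t ht
    have hAw : Tendsto (fun k => ∫ s in Ioc 0 t, A (w k s) ∂μ) atTop
        (nhds (∫ s in Ioc 0 t, A (ρ s (ũ s)) ∂μ)) := by
      refine tendsto_integral_of_dominated_convergence (fun _ => ‖A‖ * R) ?_ ?_ ?_ ?_
      · intro k
        exact (A.continuous.comp (hwc k)).aestronglyMeasurable
      · exact integrable_const _
      · intro k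
        refine ae_restrict_of_ae ?_
        filter_upwards [ae_restrict_mem measurableSet_Ioo] with s hs
        refine (A.le_opNorm _).trans ?_
        gcongr
        exact hρR s hs _
      · refine ae_restrict_of_ae ?_
        filter_upwards [ae_restrict_mem measurableSet_Ioo] with s hs
        exact (A.continuous.tendsto _).comp (hwlim s (Ioo_subset_Icc_self hs))
    have hk1 : ∀ k, ∫ s in Ioc 0 t, P (f k s) ∂μ =
        (U (φ k) t - u0) + ∫ s in Ioc 0 t, A (w k s) ∂μ := by
      intro k
      have h1 := hU (φ k) t ht.2
      have h2 : ∫ s in (0:ℝ)..t, g (φ k) s (U (φ k) (s - 1 / ((φ k : ℝ) + 1))) =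
          ∫ s in Ioc 0 t, (P (f k s) - A (w k s)) ∂μ := by
        rw [← intInd T t ht.1]
        congr 1
      have hi1 : Integrable (fun s => P (f k s)) μ := P.integrable_comp (hβ.mono' (hfm k) (hfb k))
      have hi2 : Integrable (fun s => A (w k s)) μ := by
        refine Integrable.mono' (integrable_const (‖A‖ * R))
          (A.continuous.comp (hwc k)).aestronglyMeasurable ?_
        filter_upwards [ae_restrict_mem measurableSet_Ioo] with s hs
        refine (A.le_opNorm _).trans ?_
        gcongr
        exact hρR s hs _
      rw [h2, integral_sub hi1.restrict hi2.restrict] at h1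
      rw [h1]
      abel
    have hlim : Tendsto (fun k => ∫ s in Ioc 0 t, P (f k s) ∂μ) atTop
        (nhds ((ũ t - u0) + ∫ s in Ioc 0 t, A (ρ s (ũ s)) ∂μ)) := by
      simp only [hk1]
      exact ((hũlim t ht).sub_const u0).add hAw
    have h3 := hflP P (Ioc 0 t) _ hlim
    rw [intInd T t ht.1, integral_sub hPi.restrict hAi.restrict, h3]
    abel
  have hmain : ∀ᵐ t ∂μ, fl t ∈ F t (ρ t (ũ t)) ∧
        ⟪p t - fl t, J (v t) - J (ρ t (ũ t))⟫ ≤ ℓ t * ‖J (v t) - J (ρ t (ũ t))‖ ^ 2 := by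
    filter_upwards [hflK, hFcont, hA4, hp, hselb, hFβ, ae_restrict_mem measurableSet_Ioo]
      with t k1 k2 k3 k4 k5 k6 ht
    have ht' : t ∈ Icc (0:ℝ) T := Ioo_subset_Icc_self ht
    have hw := hwlim t ht'
    obtain ⟨c1, c2, c3, c4⟩ := hF t ht' (ρ t (ũ t))
    constructor
    · have hh := k2 _ _ hw
      rw [← c2.closure_eq, Metric.closure_eq_iInter_cthickening]
      simp only [mem_iInter]
      intro ε hε
      refine k1 _ isClosed_cthickening (c4.cthickening ε) ?_
      filter_upwards [hh.eventually (gt_mem_nhds hε)] with k hk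
      obtain ⟨d1, d2, d3, d4⟩ := hF t ht' (w k t)
      obtain ⟨y, hy, hyd⟩ := exists_dist_lt_of_hausdorffDist_lt' (hselF t ht (φ k) _) hk
        (hausdorffEDist_ne_top_of_nonempty_of_bounded c1 d1 c3 d3)
      apply thickening_subset_cthickening
      rw [mem_thickening_iff]
      exact ⟨y, hy, by rw [dist_comm]; exact hyd⟩
    · set e := J (v t) - J (ρ t (ũ t)) with he
      let ek : ℕ → H := fun k => J (v t) - J (w k t)
      have hek : Tendsto ek atTop (nhds e) := ((J.continuous.tendsto _).comp hw).const_sub _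
      have hβ0 : 0 ≤ β t := (norm_nonneg _).trans k4.2
      have hest : ∀ k, ⟪p t - f k t, e⟫ ≤
          ℓ t * ‖ek k‖ ^ 2 + 4 * β t ^ 2 * hk k + 2 * β t * ‖e - ek k‖ := by
        intro k
        obtain ⟨g', hg', hgi⟩ := k3 (v t) (w k t) (p t) k4.1
        obtain ⟨d1, d2, d3, d4⟩ := hF t ht' (w k t)
        have hvar := (nproj_spec d1 d2 d4 (p t + ((φ k : ℝ) + 1) • ek k)).2 g' hg'
        change ⟪p t + ((φ k : ℝ) + 1) • ek k - f k t, g' - f k t⟫ ≤ 0 at hvar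
        have n1 : ‖f k t‖ ≤ β t := k5 _ _
        have n2 : ‖g'‖ ≤ β t := k6 _ (hρR t ht _) _ hg'
        have n3 : ‖p t - f k t‖ ≤ 2 * β t := (norm_sub_le _ _).trans (by linarith [k4.2])
        have n4 : ‖g' - f k t‖ ≤ 2 * β t := (norm_sub_le _ _).trans (by linarith)
        have s1 : ⟪p t + ((φ k : ℝ) + 1) • ek k - f k t, g' - f k t⟫ =
            ⟪p t - f k t, g' - f k t⟫ + ((φ k : ℝ) + 1) * ⟪g' - f k t, ek k⟫ := by
          rw [add_sub_right_comm, inner_add_left, real_inner_smul_left, real_inner_comm (ek k)]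
        have s2 : -(4 * β t ^ 2) ≤ ⟪p t - f k t, g' - f k t⟫ := by
          have := abs_real_inner_le_norm (p t - f k t) (g' - f k t)
          have h2 : ‖p t - f k t‖ * ‖g' - f k t‖ ≤ (2 * β t) * (2 * β t) := by gcongr
          have := neg_abs_le ⟪p t - f k t, g' - f k t⟫
          nlinarith
        have s3 : ⟪g' - f k t, ek k⟫ ≤ 4 * β t ^ 2 * hk k := by
          have hpos : (0:ℝ) < (φ k : ℝ) + 1 := by positivity
          simp only [hhk]
          rw [mul_one_div, le_div_iff₀ hpos]
          linarith
        have s4 : ⟪p t - f k t, e - ek k⟫ ≤ 2 * β t * ‖e - ek k‖ :=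
          (real_inner_le_norm _ _).trans (by gcongr)
        have s5 : ⟪p t - f k t, e⟫ = ⟪p t - g', ek k⟫ + ⟪g' - f k t, ek k⟫ +
            ⟪p t - f k t, e - ek k⟫ := by
          simp only [inner_sub_left, inner_sub_right]
          ring
        rw [s5]
        change ⟪p t - g', ek k⟫ ≤ ℓ t * ‖ek k‖ ^ 2 at hgi
        linarith
      have hestlim : Tendsto (fun k => ℓ t * ‖ek k‖ ^ 2 + 4 * β t ^ 2 * hk k + 2 * β t * ‖e - ek k‖)
          atTop (nhds (ℓ t * ‖e‖ ^ 2)) := by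
        have := (((hek.norm.pow 2).const_mul (ℓ t)).add (hklim.const_mul (4 * β t ^ 2))).add
          ((hek.const_sub e).norm.const_mul (2 * β t))
        simpa using this
      apply le_of_forall_pos_le_add
      intro ε hε
      have hK : fl t ∈ {q : H | ⟪p t, e⟫ - (ℓ t * ‖e‖ ^ 2 + ε) ≤ innerSL ℝ e q} := by
        refine k1 _ (isClosed_le continuous_const (innerSL ℝ e).continuous)
          (convex_halfSpace_ge (innerSL ℝ e).isBoundedLinearMap.toIsLinearMap _) ?_
        filter_upwards [hestlim.eventually (gt_mem_nhds (show ℓ t * ‖e‖ ^ 2 < ℓ t * ‖e‖ ^ 2 + ε by linarith))]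
          with k hk
        have := hest k
        simp only [mem_ofPred_eq, innerSL_apply_apply]
        rw [inner_sub_left] at this
        have hc1 := real_inner_comm e (f k t)
        have hc2 := real_inner_comm e (p t)
        linarith
      simp only [mem_ofPred_eq, innerSL_apply_apply] at hK
      rw [inner_sub_left, real_inner_comm e (fl t)]
      linarith
  -- final function
  have hGi : Integrable ((Ioo (0:ℝ) T).indicator (fun s => P (fl s) - A (ρ s (ũ s)))) := by
    rw [integrable_indicator_iff measurableSet_Ioo]
    exact hPi.sub hAi
  let u : ℝ → E := fun t => u0 + ∫ s in (0:ℝ)..t,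
      (Ioo (0:ℝ) T).indicator (fun s => P (fl s) - A (ρ s (ũ s))) s
  have huũ : ∀ t ∈ Icc (0:ℝ) T, u t = ũ t := fun t ht => (heq t ht).symm
  have hee : (Ioo (0:ℝ) T).indicator (fun s => P (fl s) - A (ρ s (u s))) =
      (Ioo (0:ℝ) T).indicator (fun s => P (fl s) - A (ρ s (ũ s))) := by
    ext s
    by_cases h : s ∈ Ioo (0:ℝ) T
    · simp only [indicator_of_mem h, huũ s (Ioo_subset_Icc_self h)]
    · simp only [indicator_of_notMem h]
  refine ⟨u, fl, ?_, hfli, ?_, ?_, ?_⟩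
  · exact continuous_const.add
      (intervalIntegral.continuous_primitive (fun a c => hGi.intervalIntegrable) 0)
  · intro t
    rw [hee]
  · rw [hee]; exact hGi
  · filter_upwards [hmain, ae_restrict_mem measurableSet_Ioo] with t h1 ht
    rw [huũ t (Ioo_subset_Icc_self ht)]
    exact h1


theorem core {E H : Type*} [NormedAddCommGroup E] [NormedSpace ℝ E] [FiniteDimensional ℝ E]
    [NormedAddCommGroup H] [InnerProductSpace ℝ H] [CompleteSpace H]
    [TopologicalSpace.SeparableSpace H] (T : ℝ) (hT : 0 < T) (F : ℝ → E → Set H)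
    (hF : ∀ t ∈ Icc (0:ℝ) T, ∀ v : E, (F t v).Nonempty ∧ IsClosed (F t v) ∧
      Bornology.IsBounded (F t v) ∧ Convex ℝ (F t v))
    (hFmeas : ∀ v : E, ∀ M : Set H, IsOpen M →
      MeasurableSet {t | t ∈ Icc (0:ℝ) T ∧ (F t v ∩ M).Nonempty})
    (hFcont : ∀ᵐ t ∂volume.restrict (Ioo (0:ℝ) T), ∀ v : E, ∀ vk : ℕ → E,
      Tendsto vk atTop (nhds v) →
      Tendsto (fun k => hausdorffDist (F t v) (F t (vk k))) atTop (nhds 0))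
    (J : E →L[ℝ] H) (hJ : Function.Injective J) (P : H →L[ℝ] E) (A : E →L[ℝ] E)
    (hP : ∀ h w, ⟪J (P h), J w⟫ = ⟪h, J w⟫)
    (ca : ℝ) (hca : 0 < ca) (hcoer : ∀ e, ca * ‖e‖ ^ 2 ≤ ⟪J (A e), J e⟫)
    (α : ℝ → ℝ) (hα : IntegrableOn α (Ioo 0 T)) (cF : ℝ) (hcF : 0 < cF)
    (hA3 : ∀ᵐ t ∂volume.restrict (Ioo (0:ℝ) T),
      (∀ f ∈ F t 0, ‖f‖ ≤ α t) ∧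
      ∀ u v : E, hausdorffDist (F t u) (F t v) ≤ cF * (1 + ‖u‖ + ‖v‖) * ‖J u - J v‖)
    (ℓ : ℝ → ℝ) (hℓ : IntegrableOn ℓ (Ioo 0 T))
    (hA4 : ∀ᵐ t ∂volume.restrict (Ioo (0:ℝ) T), ∀ v v2 : E, ∀ g ∈ F t v,
      ∃ g' ∈ F t v2, ⟪g - g', J v - J v2⟫ ≤ ℓ t * ‖J v - J v2‖ ^ 2)
    (u0 : E) (v v' : ℝ → E) (hv' : Integrable v')
    (hv : ∀ t, v t = v 0 + ∫ s in (0:ℝ)..t, v' s)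
    (δ : ℝ → ℝ) (hδi : IntegrableOn δ (Ioo 0 T))
    (hδ : ∀ᵐ t ∂volume.restrict (Ioo (0:ℝ) T),
      infDist (J (v' t) + J (A (v t))) (F t (v t)) ≤ δ t) :
    ∃ (u : ℝ → E) (f : ℝ → H), Continuous u ∧ IntegrableOn f (Ioo 0 T) ∧
      (∀ t, u t = u0 + ∫ s in (0:ℝ)..t, (Ioo (0:ℝ) T).indicator (fun s => P (f s) - A (u s)) s) ∧
      Integrable ((Ioo (0:ℝ) T).indicator (fun s => P (f s) - A (u s))) ∧
      (∀ᵐ t ∂volume.restrict (Ioo (0:ℝ) T), f t ∈ F t (u t)) ∧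
      (∀ C : ℝ, (∀ s t, 0 ≤ s → s ≤ t → t ≤ T →
          Real.exp (∫ τ in s..t, (Ioo (0:ℝ) T).indicator ℓ τ) ≤ C) →
        ∀ t ∈ Icc (0:ℝ) T, ‖J (v t) - J (u t)‖ ≤
          C * (‖J (v 0) - J u0‖ + ∫ τ in Ioo (0:ℝ) T, |δ τ|)) ∧
      (∀ S : ℝ, (∀ t ∈ Icc (0:ℝ) T, ‖J (v t) - J (u t)‖ ≤ S) →
        ca * (∫ t in Ioo (0:ℝ) T, ‖v t - u t‖ ^ 2) ≤
          (∫ τ in Ioo (0:ℝ) T, |δ τ|) * S + (∫ τ in Ioo (0:ℝ) T, max 0 (ℓ τ)) * S ^ 2 +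
            ‖J (v 0) - J u0‖ ^ 2) := by
  have : CompleteSpace E := FiniteDimensional.complete ℝ E
  have hvc : Continuous v := by
    have : v = fun t => v 0 + ∫ s in (0:ℝ)..t, v' s := funext hv
    rw [this]
    exact continuous_const.add (intervalIntegral.continuous_primitive
      (fun _ _ => hv'.intervalIntegrable) 0)
  obtain ⟨K, hK0, hK⟩ : ∃ K : ℝ, 0 ≤ K ∧ ∀ e, ‖e‖ ≤ K * ‖J e‖ := by
    obtain ⟨K, hK, h⟩ := (J : E →ₗ[ℝ] H).exists_antilipschitzWith (LinearMap.ker_eq_bot.2 hJ)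
    refine ⟨K, K.2, fun e => ?_⟩
    simpa using h.le_mul_norm_sub e 0
  obtain ⟨Bv, hBv⟩ : ∃ Bv, ∀ t ∈ Icc (0:ℝ) T, ‖v t‖ ≤ Bv :=
    isCompact_Icc.exists_bound_of_continuousOn hvc.continuousOn
  have hBv0 : 0 ≤ Bv := (norm_nonneg _).trans (hBv 0 ⟨le_rfl, hT.le⟩)
  set D : ℝ := ∫ τ in Ioo (0:ℝ) T, |δ τ| with hD
  have hD0 : 0 ≤ D := integral_nonneg fun _ => abs_nonneg _
  set lp : ℝ → ℝ := (Ioo (0:ℝ) T).indicator (fun t => max 0 (ℓ t)) with hlp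
  have hlpi : Integrable lp := by
    rw [hlp, integrable_indicator_iff measurableSet_Ioo]
    exact (integrable_zero _ _ _).sup hℓ
  have hlp0 : ∀ t, 0 ≤ lp t := fun t => indicator_nonneg (fun _ _ => le_max_left _ _) t
  set dd : ℝ → ℝ := (Ioo (0:ℝ) T).indicator (fun t => |δ t|) with hdd
  have hddi : Integrable dd := by
    rw [hdd, integrable_indicator_iff measurableSet_Ioo]
    exact hδi.abs
  have hdd0 : ∀ t, 0 ≤ dd t := fun t => indicator_nonneg (fun _ _ => abs_nonneg _) t
  have hddD : ∫ s in Ioo (0:ℝ) T, dd s = D := by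
    rw [hdd, setIntegral_indicator measurableSet_Ioo, inter_self]
  set L : ℝ := ∫ τ, lp τ with hL
  set M : ℝ := Real.exp L * (‖J (v 0) - J u0‖ + D) with hM
  have hM0 : 0 ≤ M := by positivity
  set R : ℝ := M + 1 with hR
  have hR0 : 0 < R := by positivity
  set lam : ℝ → E → ℝ := fun t x => R / max R ‖J (x - v t)‖ with hlam
  have hmax : ∀ t x, 0 < max R ‖J (x - v t)‖ := fun t x => lt_max_of_lt_left hR0
  have hlam0 : ∀ t x, 0 < lam t x := fun t x => div_pos hR0 (hmax t x)
  have hlam1 : ∀ t x, lam t x ≤ 1 := fun t x => (div_le_one (hmax t x)).2 (le_max_left _ _)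
  set ρ : ℝ → E → E := fun t x => v t + lam t x • (x - v t) with hρdef
  have hρc : Continuous (fun q : ℝ × E => ρ q.1 q.2) := by
    have h1 : Continuous (fun q : ℝ × E => q.2 - v q.1) :=
      continuous_snd.sub (hvc.comp continuous_fst)
    have h2 : Continuous (fun q : ℝ × E => lam q.1 q.2) :=
      continuous_const.div (continuous_const.max (J.continuous.comp h1).norm)
        (fun q => (hmax q.1 q.2).ne')
    exact (hvc.comp continuous_fst).add (h2.smul h1)
  set R' : ℝ := Bv + K * R with hR'
  have hR'0 : 0 ≤ R' := by positivity
  have hρR : ∀ t ∈ Ioo (0:ℝ) T, ∀ e, ‖ρ t e‖ ≤ R' := by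
    intro t ht e
    refine (norm_add_le _ _).trans (add_le_add (hBv t (Ioo_subset_Icc_self ht)) ?_)
    refine (hK _).trans ?_
    gcongr
    rw [map_smul, norm_smul, Real.norm_of_nonneg (hlam0 t e).le]
    simp only [hlam]
    rw [div_mul_eq_mul_div, div_le_iff₀ (hmax t e)]
    gcongr
    exact le_max_right _ _
  set β : ℝ → ℝ := fun t => α t + cF * (1 + R') * (‖J‖ * R') with hβdef
  have hβ : IntegrableOn β (Ioo 0 T) := by
    refine Integrable.add hα ?_
    exact integrable_const _
  have hFβ : ∀ᵐ t ∂volume.restrict (Ioo (0:ℝ) T), ∀ e, ‖e‖ ≤ R' → ∀ f ∈ F t e, ‖f‖ ≤ β t := by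
    filter_upwards [hA3, ae_restrict_mem measurableSet_Ioo] with t h3 ht e he f hf
    apply le_of_forall_pos_le_add
    intro ε hε
    have ht' := Ioo_subset_Icc_self ht
    obtain ⟨a1, -, a3, -⟩ := hF t ht' e
    obtain ⟨b1, -, b3, -⟩ := hF t ht' 0
    have hlt : hausdorffDist (F t e) (F t 0) < cF * (1 + R') * (‖J‖ * R') + ε := by
      refine lt_of_le_of_lt (h3.2 e 0) ?_
      rw [map_zero, sub_zero, norm_zero, add_zero]
      refine lt_of_le_of_lt ?_ (lt_add_of_pos_right _ hε)
      gcongr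
      exact (J.le_opNorm e).trans (by gcongr)
    obtain ⟨g, hg, hfg⟩ := exists_dist_lt_of_hausdorffDist_lt hf hlt
      (hausdorffEDist_ne_top_of_nonempty_of_bounded a1 b1 a3 b3)
    have := h3.1 g hg
    rw [dist_eq_norm] at hfg
    have h4 : ‖f‖ ≤ ‖f - g‖ + ‖g‖ := by simpa using norm_add_le (f - g) g
    simp only [hβdef]
    linarith
  set z : ℝ → E := fun t => v' t + A (v t) with hz
  set p : ℝ → H := fun t => nproj (F t (v t)) (J (z t)) with hpdef
  have hpm : AEStronglyMeasurable p (volume.restrict (Ioo (0:ℝ) T)) := by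
    refine sel_meas T F hF hFmeas hFcont v (fun t => J (z t)) hvc.aestronglyMeasurable ?_
    exact J.continuous.comp_aestronglyMeasurable
      (hv'.aestronglyMeasurable.restrict.add (A.continuous.comp hvc).aestronglyMeasurable)
  have hpF : ∀ t ∈ Ioo (0:ℝ) T, p t ∈ F t (v t) := fun t ht => by
    obtain ⟨a1, a2, a3, a4⟩ := hF t (Ioo_subset_Icc_self ht) (v t)
    exact (nproj_spec a1 a2 a4 _).1
  have hpd : ∀ᵐ t ∂volume.restrict (Ioo (0:ℝ) T), ‖J (z t) - p t‖ ≤ |δ t| := by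
    filter_upwards [hδ, ae_restrict_mem measurableSet_Ioo] with t h ht
    obtain ⟨a1, a2, a3, a4⟩ := hF t (Ioo_subset_Icc_self ht) (v t)
    simp only [hpdef]
    rw [nproj_dist a1 a2 a4, hz, map_add]
    exact h.trans (le_abs_self _)
  have hp : ∀ᵐ t ∂volume.restrict (Ioo (0:ℝ) T), p t ∈ F t (v t) ∧ ‖p t‖ ≤ β t := by
    filter_upwards [hFβ, ae_restrict_mem measurableSet_Ioo] with t h ht
    refine ⟨hpF t ht, h (v t) ?_ _ (hpF t ht)⟩
    refine (hBv t (Ioo_subset_Icc_self ht)).trans ?_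
    rw [hR']
    have : 0 ≤ K * R := by positivity
    linarith
  obtain ⟨u, f, huc, hfi, hu, hui, hfu⟩ := trunc_exists T hT F hF hFmeas hFcont J P A ℓ hA4 ρ hρc R'
    hρR β hβ hFβ v hvc p hpm hp u0
  set G : ℝ → E := (Ioo (0:ℝ) T).indicator (fun s => P (f s) - A (ρ s (u s))) with hG
  have hu00 : u 0 = u0 := by rw [hu 0]; simp
  set x : ℝ → H := fun t => J (v t - u t) with hxdef
  set x' : ℝ → H := fun t => J (v' t - G t) with hx'def
  have hx' : Integrable x' := J.integrable_comp (hv'.sub hui)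
  have hx : ∀ t, x t = x 0 + ∫ s in (0:ℝ)..t, x' s := by
    intro t
    simp only [hxdef, hx'def]
    have hvG : Integrable (fun t => v' t - G t) := hv'.sub hui
    rw [J.intervalIntegral_comp_comm hvG.intervalIntegrable, ← map_add,
      intervalIntegral.integral_sub hv'.intervalIntegrable hui.intervalIntegrable, hu00]
    congr 1
    conv_lhs => rw [hv t, hu t]
    abel
  have hx0 : ‖x 0‖ = ‖J (v 0) - J u0‖ := by simp only [hxdef, hu00, map_sub]
  have hkey : ∀ᵐ t ∂volume.restrict (Ioo (0:ℝ) T), ⟪x' t, x t⟫ ≤ |δ t| * ‖x t‖ +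
      lam t (u t) * (ℓ t * ‖x t‖ ^ 2) - lam t (u t) * (ca * ‖v t - u t‖ ^ 2) := by
    filter_upwards [hfu, hpd, ae_restrict_mem measurableSet_Ioo] with t h1 h2 ht
    set c := lam t (u t) with hc
    have hc0 : 0 < c := hlam0 t (u t)
    have hρe : ρ t (u t) = v t - c • (v t - u t) := by
      simp only [hρdef]
      rw [← hc, ← neg_sub (v t) (u t), smul_neg, ← sub_eq_add_neg]
    have e1 : J (v t) - J (ρ t (u t)) = c • x t := by
      rw [hρe, ← map_sub, sub_sub_cancel, map_smul]
    have h3 := h1.2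
    rw [e1, inner_smul_right, norm_smul, Real.norm_of_nonneg hc0.le] at h3
    have h4 : ⟪p t - f t, x t⟫ ≤ c * (ℓ t * ‖x t‖ ^ 2) := by
      refine le_of_mul_le_mul_left ?_ hc0
      calc _ ≤ _ := h3
        _ = _ := by ring
    have h5 : ⟪J (z t) - p t, x t⟫ ≤ |δ t| * ‖x t‖ :=
      (real_inner_le_norm _ _).trans (by gcongr)
    have h6 : x' t = J (z t) - J (P (f t)) - c • J (A (v t - u t)) := by
      simp only [hx'def, hG, indicator_of_mem ht, hρe, hz, map_sub, map_add, map_smul, smul_sub]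
      abel
    have h7 : c * (ca * ‖v t - u t‖ ^ 2) ≤ c * ⟪J (A (v t - u t)), x t⟫ :=
      mul_le_mul_of_nonneg_left (hcoer _) hc0.le
    have h8 : ⟪J (P (f t)), x t⟫ = ⟪f t, x t⟫ := hP _ _
    rw [h6, inner_sub_left, inner_sub_left, inner_smul_left, h8]
    rw [inner_sub_left] at h4 h5
    simp only [conj_trivial]
    linarith
  -- phase 1
  have hxM : ∀ t ∈ Icc (0:ℝ) T, ‖x t‖ ≤ M := by
    intro t ht
    have := gronwall_ac hx' hx lp dd hlpi hddi hdd0 T (Real.exp L) ?_ ?_ t ht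
    · rwa [hddD, hx0] at this
    · filter_upwards [hkey, ae_restrict_mem measurableSet_Ioo] with t h ht
      simp only [hlp, hdd, indicator_of_mem ht]
      refine h.trans ?_
      have a1 : 0 ≤ lam t (u t) * (ca * ‖v t - u t‖ ^ 2) :=
        mul_nonneg (hlam0 _ _).le (by positivity)
      have a2 : lam t (u t) * (ℓ t * ‖x t‖ ^ 2) ≤ max 0 (ℓ t) * ‖x t‖ ^ 2 := by
        rw [← mul_assoc]
        gcongr
        calc lam t (u t) * ℓ t ≤ lam t (u t) * max 0 (ℓ t) :=
              mul_le_mul_of_nonneg_left (le_max_right _ _) (hlam0 _ _).le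
          _ ≤ 1 * max 0 (ℓ t) := mul_le_mul_of_nonneg_right (hlam1 _ _) (le_max_left _ _)
          _ = _ := one_mul _
      linarith
    · intro s t _ hst _
      refine Real.exp_le_exp.2 ?_
      rw [intervalIntegral.integral_of_le hst]
      exact setIntegral_le_integral hlpi (Eventually.of_forall hlp0)
  have hlamu : ∀ t ∈ Icc (0:ℝ) T, lam t (u t) = 1 := by
    intro t ht
    simp only [hlam]
    have : ‖J (u t - v t)‖ ≤ R := by
      have := hxM t ht
      simp only [hxdef] at this
      rw [← neg_sub, map_neg, norm_neg]
      linarith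
    rw [max_eq_left this, div_self hR0.ne']
  have hρu : ∀ t ∈ Icc (0:ℝ) T, ρ t (u t) = u t := by
    intro t ht
    simp only [hρdef]
    rw [hlamu t ht, one_smul]
    abel
  have hGe : G = (Ioo (0:ℝ) T).indicator (fun s => P (f s) - A (u s)) := by
    rw [hG]
    refine indicator_congr fun s hs => ?_
    rw [hρu s (Ioo_subset_Icc_self hs)]
  have hkey2 : ∀ᵐ t ∂volume.restrict (Ioo (0:ℝ) T), ⟪x' t, x t⟫ ≤ |δ t| * ‖x t‖ +
      ℓ t * ‖x t‖ ^ 2 - ca * ‖v t - u t‖ ^ 2 := by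
    filter_upwards [hkey, ae_restrict_mem measurableSet_Ioo] with t h ht
    rwa [hlamu t (Ioo_subset_Icc_self ht), one_mul, one_mul] at h
  have hxe : ∀ t, ‖x t‖ = ‖J (v t) - J (u t)‖ := fun t => by simp only [hxdef, map_sub]
  refine ⟨u, f, huc, hfi, ?_, ?_, ?_, ?_, ?_⟩
  · rw [← hGe]; exact hu
  · rw [← hGe]; exact hui
  · filter_upwards [hfu, ae_restrict_mem measurableSet_Ioo] with t h ht
    rw [← hρu t (Ioo_subset_Icc_self ht)]
    exact h.1
  · intro C hC t ht
    have := gronwall_ac hx' hx ((Ioo (0:ℝ) T).indicator ℓ) dd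
      ((integrable_indicator_iff measurableSet_Ioo).2 hℓ) hddi hdd0 T C ?_ hC t ht
    · rwa [hddD, hx0, hxe] at this
    · filter_upwards [hkey2, ae_restrict_mem measurableSet_Ioo] with t h ht
      simp only [hdd, indicator_of_mem ht]
      have : 0 ≤ ca * ‖v t - u t‖ ^ 2 := by positivity
      linarith
  · intro S hS
    have hei : IntegrableOn (fun t => ‖v t - u t‖ ^ 2) (Ioo 0 T) :=
      (((hvc.sub huc).norm.pow 2).continuousOn.integrableOn_Icc (a := 0) (b := T)).mono_set
        Ioo_subset_Icc_self
    have hlpo : IntegrableOn (fun t => max 0 (ℓ t)) (Ioo 0 T) :=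
      (integrable_indicator_iff measurableSet_Ioo).1 hlpi
    set q0 : ℝ → ℝ := fun t => 2 * (|δ t| * S + max 0 (ℓ t) * S ^ 2 - ca * ‖v t - u t‖ ^ 2) with hq0
    have i1 : IntegrableOn (fun t => |δ t| * S) (Ioo 0 T) := Integrable.mul_const hδi.abs S
    have i2 : IntegrableOn (fun t => max 0 (ℓ t) * S ^ 2) (Ioo 0 T) := hlpo.mul_const (S ^ 2)
    have i3 : IntegrableOn (fun t => ca * ‖v t - u t‖ ^ 2) (Ioo 0 T) := hei.const_mul ca
    have i12 : IntegrableOn (fun t => |δ t| * S + max 0 (ℓ t) * S ^ 2) (Ioo 0 T) := i1.add i2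
    have hqi : IntegrableOn q0 (Ioo 0 T) := ((i1.add i2).sub i3).const_mul 2
    have := energy_identity hx' hx ((Ioo (0:ℝ) T).indicator q0)
      ((integrable_indicator_iff measurableSet_Ioo).2 hqi) T hT.le ?_
    · rw [setIntegral_indicator measurableSet_Ioo, inter_self, hq0, integral_const_mul,
        integral_sub i12 i3, integral_add i1 i2, integral_mul_const, integral_mul_const,
        integral_const_mul, hx0] at this
      have h1 := sq_nonneg ‖x T‖
      have h2 := sq_nonneg ‖J (v 0) - J u0‖
      linarith
    · filter_upwards [hkey2, ae_restrict_mem measurableSet_Ioo] with t h ht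
      simp only [indicator_of_mem ht, hq0]
      have hs := hS t (Ioo_subset_Icc_self ht)
      rw [← hxe] at hs
      have a1 : |δ t| * ‖x t‖ ≤ |δ t| * S := by gcongr
      have a2 : ℓ t * ‖x t‖ ^ 2 ≤ max 0 (ℓ t) * S ^ 2 := by
        have : ‖x t‖ ^ 2 ≤ S ^ 2 := by gcongr
        exact mul_le_mul (le_max_right _ _) this (sq_nonneg _) (le_max_left _ _)
      linarith




/-- Filippov-type theorem for the Galerkin inclusion: given an
approximate solution `v_N` with defect `δ_N`, there is an exact Galerkin solution
`u_N` with the explicit `L∞(0,T;H)`- and `L²(0,T;V)`-estimates (i) and (ii). -/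
theorem stmt_10
    {V H : Type*}
    [NormedAddCommGroup V] [InnerProductSpace ℝ V] [CompleteSpace V]
    [TopologicalSpace.SeparableSpace V]
    [NormedAddCommGroup H] [InnerProductSpace ℝ H] [CompleteSpace H]
    [TopologicalSpace.SeparableSpace H]
    (ι : V →L[ℝ] H) (hι_inj : Function.Injective ι) (hι_dense : DenseRange ι)
    (hι_cpt : IsCompactOperator ι)
    (T : ℝ) (hT : 0 < T)
    -- (A1)
    (a : V →ₗ[ℝ] V →ₗ[ℝ] ℝ) (ca Ca : ℝ) (hca : 0 < ca) (hCa : 0 < Ca)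
    (hcoer : ∀ v : V, ca * ‖v‖ ^ 2 ≤ a v v)
    (habd : ∀ v w : V, a v w ≤ Ca * ‖v‖ * ‖w‖)
    -- (A2)
    (F : ℝ → V → Set H)
    (hF : ∀ t ∈ Icc (0:ℝ) T, ∀ v : V, (F t v).Nonempty ∧ IsClosed (F t v) ∧
      Bornology.IsBounded (F t v) ∧ Convex ℝ (F t v))
    (hFmeas : ∀ v : V, ∀ M : Set H, IsOpen M →
      MeasurableSet {t | t ∈ Icc (0:ℝ) T ∧ (F t v ∩ M).Nonempty})
    (hFcont : ∀ᵐ t ∂volume.restrict (Ioo (0:ℝ) T), ∀ v : V, ∀ vk : ℕ → V,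
      Tendsto vk atTop (nhds v) →
      Tendsto (fun k => hausdorffDist (F t v) (F t (vk k))) atTop (nhds 0))
    -- (A3)
    (α : ℝ → ℝ) (hα : IntegrableOn α (Ioo 0 T)) (cF : ℝ) (hcF : 0 < cF)
    (hA3 : ∀ᵐ t ∂volume.restrict (Ioo (0:ℝ) T),
      (∀ f ∈ F t 0, ‖f‖ ≤ α t) ∧
      ∀ u v : V, hausdorffDist (F t u) (F t v) ≤ cF * (1 + ‖u‖ + ‖v‖) * ‖ι u - ι v‖)
    -- (A4)
    (ℓ : ℝ → ℝ) (hℓ : IntegrableOn ℓ (Ioo 0 T))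
    (hA4 : ∀ᵐ t ∂volume.restrict (Ioo (0:ℝ) T), ∀ v v2 : V, ∀ g ∈ F t v,
      ∃ g' ∈ F t v2, ⟪g - g', ι v - ι v2⟫ ≤ ℓ t * ‖ι v - ι v2‖ ^ 2)
    -- the finite-dimensional subspace and the operator A_N
    (VN : Submodule ℝ V) (hVNfd : FiniteDimensional ℝ VN)
    (AN : V → V) (hANmem : ∀ v ∈ VN, AN v ∈ VN)
    (hANdef : ∀ v ∈ VN, ∀ w ∈ VN, ⟪ι (AN v), ι w⟫ = a v w)
    -- the approximate solution v_N and its defect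
    (uN0 : V) (huN0 : uN0 ∈ VN)
    (vN vN' : ℝ → V)
    (hvNmem : ∀ t ∈ Icc (0:ℝ) T, vN t ∈ VN)
    (hvN'mem : ∀ᵐ t ∂volume.restrict (Ioo (0:ℝ) T), vN' t ∈ VN)
    (hvN'int : IntegrableOn vN' (Ioo 0 T))
    (hvNFTC : ∀ t ∈ Icc (0:ℝ) T, vN t = vN 0 + ∫ s in (0:ℝ)..t, vN' s)
    (δN : ℝ → ℝ) (hδNint : IntegrableOn δN (Ioo 0 T))
    (hδN : ∀ᵐ t ∂volume.restrict (Ioo (0:ℝ) T),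
      infDist (ι (vN' t) + ι (AN (vN t))) (F t (vN t)) ≤ δN t) :
    ∃ uN uN' : ℝ → V, ∃ fN : ℝ → H,
      (∀ t ∈ Icc (0:ℝ) T, uN t ∈ VN) ∧
      (∀ᵐ t ∂volume.restrict (Ioo (0:ℝ) T), uN' t ∈ VN) ∧
      IntegrableOn uN' (Ioo 0 T) ∧
      (∀ t ∈ Icc (0:ℝ) T, uN t = uN 0 + ∫ s in (0:ℝ)..t, uN' s) ∧
      uN 0 = uN0 ∧
      IntegrableOn fN (Ioo 0 T) ∧
      (∀ᵐ t ∂volume.restrict (Ioo (0:ℝ) T), ∀ v ∈ VN,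
        ⟪ι (uN' t), ι v⟫ + a (uN t) v = ⟪fN t, ι v⟫) ∧
      (∀ᵐ t ∂volume.restrict (Ioo (0:ℝ) T), fN t ∈ F t (uN t)) ∧
      -- (i)
      (∀ t ∈ Icc (0:ℝ) T,
        ‖ι (vN t) - ι (uN t)‖ ≤
          sSup {x : ℝ | ∃ s t' : ℝ, 0 ≤ s ∧ s ≤ t' ∧ t' ≤ T ∧
              x = Real.exp (∫ τ in s..t', ℓ τ)} *
            (‖ι (vN 0) - ι uN0‖ + (∫ τ in Ioo (0:ℝ) T, |δN τ|))) ∧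
      -- (ii)
      ca * (∫ t in Ioo (0:ℝ) T, ‖vN t - uN t‖ ^ 2) ≤
        (∫ τ in Ioo (0:ℝ) T, |δN τ|) * (⨆ t : Icc (0:ℝ) T, ‖ι (vN t) - ι (uN t)‖) +
          (∫ τ in Ioo (0:ℝ) T, max 0 (ℓ τ)) * (⨆ t : Icc (0:ℝ) T, ‖ι (vN t) - ι (uN t)‖) ^ 2 +
          ‖ι (vN 0) - ι uN0‖ ^ 2 := by
  have hVc : CompleteSpace VN := FiniteDimensional.complete ℝ VN
  set J : VN →L[ℝ] H := ι.comp VN.subtypeL with hJdef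
  have hJa : ∀ e : VN, J e = ι (e : V) := fun e => rfl
  have hJ : Function.Injective J := fun x y h => Subtype.ext (hι_inj h)
  -- the projection
  obtain ⟨P, hP⟩ : ∃ P : H →L[ℝ] VN, ∀ h w, ⟪J (P h), J w⟫ = ⟪h, J w⟫ := by
    let Rg : Submodule ℝ H := LinearMap.range (J : VN →ₗ[ℝ] H)
    have : FiniteDimensional ℝ Rg := inferInstance
    let eqv : VN ≃ₗ[ℝ] Rg := LinearEquiv.ofInjective (J : VN →ₗ[ℝ] H) hJ
    let S : Rg →L[ℝ] VN := LinearMap.toContinuousLinearMap (eqv.symm : Rg →ₗ[ℝ] VN)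
    refine ⟨S.comp Rg.orthogonalProjectionOnto, fun h w => ?_⟩
    have h1 : J (S (Rg.orthogonalProjectionOnto h)) = (Rg.orthogonalProjectionOnto h : H) := by
      have := congrArg Subtype.val (eqv.apply_symm_apply (Rg.orthogonalProjectionOnto h))
      exact this
    have h2 : J w ∈ Rg := ⟨w, rfl⟩
    change ⟪J (S (Rg.orthogonalProjectionOnto h)), J w⟫ = _
    rw [h1]
    have h3 := Rg.starProjection_inner_eq_zero h (J w) h2
    rw [Submodule.starProjection_apply] at h3
    rw [inner_sub_left] at h3
    linarith
  -- the operator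
  have huniq : ∀ x y : VN, (∀ w : VN, ⟪J x, J w⟫ = ⟪J y, J w⟫) → x = y := by
    intro x y h
    apply hJ
    have := h (x - y)
    rw [← sub_eq_zero, ← inner_sub_left, map_sub] at this
    exact sub_eq_zero.1 (inner_self_eq_zero.1 this)
  let A0 : VN → VN := fun e => ⟨AN e, hANmem e e.2⟩
  have hA0 : ∀ e w : VN, ⟪J (A0 e), J w⟫ = a e w := fun e w => hANdef e e.2 w w.2
  let Al : VN →ₗ[ℝ] VN :=
    { toFun := A0
      map_add' := fun x y => by
        apply huniq
        intro w
        rw [map_add, inner_add_left, hA0, hA0, hA0]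
        simp
      map_smul' := fun c x => by
        apply huniq
        intro w
        rw [RingHom.id_apply, map_smul, real_inner_smul_left, hA0, hA0]
        simp }
  let A : VN →L[ℝ] VN := LinearMap.toContinuousLinearMap Al
  have hAA : ∀ e : VN, ((A e : VN) : V) = AN e := fun e => rfl
  have hA : ∀ e w : VN, ⟪J (A e), J w⟫ = a e w := hA0
  -- the approximate solution
  let Q : V →L[ℝ] VN := VN.orthogonalProjectionOnto
  have hQ : ∀ x ∈ VN, ((Q x : VN) : V) = x := fun x hx =>
    Submodule.starProjection_eq_self_iff.2 hx
  set v' : ℝ → VN := (Ioo (0:ℝ) T).indicator (fun t => Q (vN' t)) with hv'def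
  have hv' : Integrable v' := by
    rw [hv'def, integrable_indicator_iff measurableSet_Ioo]
    exact Q.integrable_comp hvN'int
  set v : ℝ → VN := fun t => Q (vN 0) + ∫ s in (0:ℝ)..t, v' s with hvdef
  have hv0 : v 0 = Q (vN 0) := by simp [hvdef]
  have hv : ∀ t, v t = v 0 + ∫ s in (0:ℝ)..t, v' s := fun t => by rw [hv0]
  have hIoc : ∀ (G1 G2 : ℝ → V), (∀ᵐ s ∂volume.restrict (Ioo (0:ℝ) T), G1 s = G2 s) →
      ∀ s t, 0 ≤ s → s ≤ t → t ≤ T → ∫ τ in s..t, G1 τ = ∫ τ in s..t, G2 τ := by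
    intro G1 G2 h s t hs hst ht
    rw [intervalIntegral.integral_of_le hst, intervalIntegral.integral_of_le hst,
      integral_Ioc_eq_integral_Ioo, integral_Ioc_eq_integral_Ioo]
    exact integral_congr_ae (ae_restrict_of_ae_restrict_of_subset (Ioo_subset_Ioo hs ht) h)
  have hvv : ∀ t ∈ Icc (0:ℝ) T, (v t : V) = vN t := by
    intro t ht
    rw [hvNFTC t ht]
    simp only [hvdef]
    rw [Submodule.coe_add, hQ _ (hvNmem 0 ⟨le_rfl, hT.le⟩)]
    congr 1
    have h1 := VN.subtypeL.intervalIntegral_comp_comm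
      (hv'.intervalIntegrable (a := 0) (b := t))
    refine h1.symm.trans (hIoc _ _ ?_ 0 t le_rfl ht.1 ht.2)
    filter_upwards [hvN'mem, ae_restrict_mem measurableSet_Ioo] with s h hs
    rw [hv'def, indicator_of_mem hs]
    exact hQ _ h
  obtain ⟨u, f, huc, hfi, hu, hui, hfu, hi, hii⟩ := core T hT (fun t (e : VN) => F t (e : V))
    (fun t ht e => hF t ht e) (fun e => hFmeas e)
    (by
      filter_upwards [hFcont] with t h e ek hek
      exact h e (fun k => ek k) ((continuous_subtype_val.tendsto e).comp hek))
    J hJ P A hP ca hca (fun e => by rw [hA]; exact hcoer e) α hα cF hcF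
    (by
      filter_upwards [hA3] with t h
      exact ⟨h.1, fun x y => h.2 x y⟩)
    ℓ hℓ
    (by
      filter_upwards [hA4] with t h x y
      exact h x y)
    ⟨uN0, huN0⟩ v v' hv' hv δN hδNint
    (by
      filter_upwards [hδN, hvN'mem, ae_restrict_mem measurableSet_Ioo] with t h h1 ht
      have e1 : (v t : V) = vN t := hvv t (Ioo_subset_Icc_self ht)
      have e2 : ((v' t : VN) : V) = vN' t := by
        rw [hv'def, indicator_of_mem ht]
        exact hQ _ h1
      rw [hJa, hJa, hAA, e1, e2]
      exact h)
  set G : ℝ → VN := (Ioo (0:ℝ) T).indicator (fun s => P (f s) - A (u s)) with hG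
  have hu00 : u 0 = ⟨uN0, huN0⟩ := by rw [hu 0]; simp
  have hdiff : ∀ t ∈ Icc (0:ℝ) T, J (v t) - J (u t) = ι (vN t) - ι (u t) := by
    intro t ht
    rw [hJa, hJa, hvv t ht]
  have hd0 : J (v 0) - J (⟨uN0, huN0⟩ : VN) = ι (vN 0) - ι uN0 := by
    rw [hJa, hJa, hvv 0 ⟨le_rfl, hT.le⟩]
  have hvc : Continuous v :=
    continuous_const.add (intervalIntegral.continuous_primitive
      (fun _ _ => hv'.intervalIntegrable) 0)
  refine ⟨fun t => u t, fun t => G t, f, fun t _ => (u t).2,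
    Eventually.of_forall fun t => (G t).2, ?_, ?_, ?_, hfi, ?_, hfu, ?_, ?_⟩
  · exact (VN.subtypeL.integrable_comp hui).integrableOn
  · intro t _
    have h1 := VN.subtypeL.intervalIntegral_comp_comm
      (hui.intervalIntegrable (a := 0) (b := t))
    change (u t : V) = (u 0 : V) + ∫ s in (0:ℝ)..t, VN.subtypeL (G s)
    rw [h1, hu00, hu t]
    rfl
  · change (u 0 : V) = uN0
    rw [hu00]
  · filter_upwards [ae_restrict_mem measurableSet_Ioo] with t ht w hw
    have h1 : ι (G t : V) = J (P (f t)) - J (A (u t)) := by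
      rw [← map_sub, hG, indicator_of_mem ht]
      rfl
    have h2 := hP (f t) ⟨w, hw⟩
    have h3 := hA (u t) ⟨w, hw⟩
    rw [h1, inner_sub_left]
    change ⟪J (P (f t)), ι w⟫ = ⟪f t, ι w⟫ at h2
    change ⟪J (A (u t)), ι w⟫ = a (u t) w at h3
    rw [h2, h3]
    ring
  · intro t ht
    have hℓI : Integrable ((Ioo (0:ℝ) T).indicator ℓ) :=
      (integrable_indicator_iff measurableSet_Ioo).2 hℓ
    have hgInt : ∀ s t', 0 ≤ s → s ≤ t' → t' ≤ T →
        ∫ τ in s..t', ℓ τ = ∫ τ in s..t', (Ioo (0:ℝ) T).indicator ℓ τ := by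
      intro s t' hs hst ht'
      rw [intervalIntegral.integral_of_le hst, intervalIntegral.integral_of_le hst,
        integral_Ioc_eq_integral_Ioo, integral_Ioc_eq_integral_Ioo]
      refine setIntegral_congr_fun measurableSet_Ioo fun τ hτ => ?_
      rw [indicator_of_mem (Ioo_subset_Ioo hs ht' hτ)]
    have hbdd : BddAbove {x : ℝ | ∃ s t' : ℝ, 0 ≤ s ∧ s ≤ t' ∧ t' ≤ T ∧
        x = Real.exp (∫ τ in s..t', ℓ τ)} := by
      refine ⟨Real.exp (∫ τ, ‖(Ioo (0:ℝ) T).indicator ℓ τ‖), ?_⟩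
      rintro _ ⟨s, t', hs, hst, ht', rfl⟩
      rw [hgInt s t' hs hst ht']
      refine Real.exp_le_exp.2 ((le_abs_self _).trans ?_)
      rw [← Real.norm_eq_abs]
      rw [intervalIntegral.integral_of_le hst]
      refine (norm_integral_le_integral_norm _).trans ?_
      exact setIntegral_le_integral hℓI.norm (Eventually.of_forall fun _ => norm_nonneg _)
    have := hi _ (fun s t' hs hst ht' => by
      rw [← hgInt s t' hs hst ht']
      exact le_csSup hbdd ⟨s, t', hs, hst, ht', rfl⟩) t ht
    rwa [hdiff t ht, hd0] at this
  · have hbd : BddAbove (range fun t : Icc (0:ℝ) T => ‖ι (vN t) - ι (u t)‖) := by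
      obtain ⟨B, hB⟩ := isCompact_Icc.exists_bound_of_continuousOn (s := Icc (0:ℝ) T)
        ((J.continuous.comp hvc).sub (J.continuous.comp huc)).continuousOn
      refine ⟨B, ?_⟩
      rintro _ ⟨t, rfl⟩
      have := hB t t.2
      change ‖J (v t) - J (u t)‖ ≤ B at this
      rwa [hdiff t t.2] at this
    have := hii (⨆ t : Icc (0:ℝ) T, ‖ι (vN t) - ι (u t)‖) (fun t ht => by
      rw [hdiff t ht]
      exact le_ciSup hbd ⟨t, ht⟩)
    rw [hd0] at this
    refine le_trans (le_of_eq ?_) this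
    congr 1
    refine setIntegral_congr_fun measurableSet_Ioo fun t ht => ?_
    change ‖vN t - u t‖ ^ 2 = ‖v t - u t‖ ^ 2
    rw [← hvv t (Ioo_subset_Icc_self ht)]
    rfl
end
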